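/- arXiv:1410.5804 — 2 statements merged into one kernel-verified Lean document; each statement's English description precedes it below -/
import Mathlib

section
/- Let ℓ, ℓ' be geodesic lines of ℍ and g, g' ∈ PSL(2,ℝ). The right AdS crooked planes g·C*(ℓ) = {g h : h ∈ C*(ℓ)} and g'·C*(ℓ') are disjoint subsets of PSL(2,ℝ) if and only if there exists K > 0 such that d(g·x, g'·x') ≤ d(x, x') − K for all x ∈ ℓ and x' ∈ ℓ'. -/
noncomputable section

open Filter Topology Pointwise
open scoped UpperHalfPlane

/-- `SL(2,ℝ)`. -/
abbrev SL2 := Matrix.SpecialLinearGroup (Fin 2) ℝ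

instance : TopologicalSpace SL2 :=
  TopologicalSpace.induced (fun A : SL2 => (A : Matrix (Fin 2) (Fin 2) ℝ)) inferInstance

/-- `PSL(2,ℝ) = SL(2,ℝ)/{±I}`. -/
abbrev PSL2 := SL2 ⧸ Subgroup.center SL2

/-- The Möbius action of an element of `PSL(2,ℝ)` on the upper half-plane,
computed via an (arbitrary) lift to `SL(2,ℝ)`; this is well defined since
`-I` acts trivially. -/
def pslSMul (g : PSL2) (z : ℍ) : ℍ := (Quotient.out g) • z

/-- Image of a subset of `ℍ` under the Möbius action of `g ∈ PSL(2,ℝ)`. -/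
def pslImg (g : PSL2) (s : Set ℍ) : Set ℍ := pslSMul g '' s

/-- A geodesic line of `ℍ`: the image of an isometric embedding of `ℝ` into `ℍ`. -/
def IsGeodesicLine (l : Set ℍ) : Prop := ∃ γ : ℝ → ℍ, Isometry γ ∧ Set.range γ = l

/-- The embedding of `ℍ` into the one-point compactification of `ℂ`. -/
def embH (z : ℍ) : OnePoint ℂ := ((z : ℂ) : OnePoint ℂ)

/-- The embedding of `∂∞ℍ = ℝ ∪ {∞}` into the one-point compactification of `ℂ`. -/
def toC : OnePoint ℝ → OnePoint ℂ := OnePoint.map Complex.ofReal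

/-- The vector `v(ξ) ∈ ℝ²` associated with a boundary point `ξ ∈ ℝ ∪ {∞}`:
`v(ξ) = (ξ, 1)` for `ξ ∈ ℝ` and `v(∞) = (1, 0)`. -/
def bvec (ξ : OnePoint ℝ) : Fin 2 → ℝ := Option.elim ξ ![1, 0] (fun r => ![r, 1])

/-- The extended Möbius action of `PSL(2,ℝ)` on `∂∞ℍ = ℝ ∪ {∞}`. -/
def bdSMul (g : PSL2) (ξ : OnePoint ℝ) : OnePoint ℝ :=
  let w := ((Quotient.out g : SL2) : Matrix (Fin 2) (Fin 2) ℝ).mulVec (bvec ξ)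
  if w 1 = 0 then OnePoint.infty else ((w 0 / w 1 : ℝ) : OnePoint ℝ)

/-- `ξ ∈ ℝ ∪ {∞}` is an endpoint of the geodesic line `l`: some isometric
parametrization of `l` tends to `ξ` (in the one-point compactification of `ℂ`). -/
def IsEndpoint (l : Set ℍ) (ξ : OnePoint ℝ) : Prop :=
  ∃ γ : ℝ → ℍ, Isometry γ ∧ Set.range γ = l ∧
    Tendsto (fun t => embH (γ t)) atTop (𝓝 (toC ξ))

/-- `h ∈ PSL(2,ℝ)` has a nonattracting fixed point at `ξ ∈ ℝ ∪ {∞}`. -/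
def HasNonattracting (h : PSL2) (ξ : OnePoint ℝ) : Prop :=
  ∃ A : SL2, (QuotientGroup.mk A : PSL2) = h ∧
    ∃ μ : ℝ, |μ| ≤ 1 ∧ (A : Matrix (Fin 2) (Fin 2) ℝ).mulVec (bvec ξ) = μ • bvec ξ

/-- `h ∈ PSL(2,ℝ)` has a nonrepelling fixed point at `ξ ∈ ℝ ∪ {∞}`. -/
def HasNonrepelling (h : PSL2) (ξ : OnePoint ℝ) : Prop :=
  ∃ A : SL2, (QuotientGroup.mk A : PSL2) = h ∧
    ∃ μ : ℝ, 1 ≤ |μ| ∧ (A : Matrix (Fin 2) (Fin 2) ℝ).mulVec (bvec ξ) = μ • bvec ξ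

/-- The right AdS crooked plane `C*(l)` centered at the identity. -/
def rightCrooked (l : Set ℍ) : Set PSL2 :=
  {h | (∃ x ∈ l, pslSMul h x = x) ∨ ∃ ξ, IsEndpoint l ξ ∧ HasNonattracting h ξ}

/-- The left AdS crooked plane `C(l)` centered at the identity. -/
def leftCrooked (l : Set ℍ) : Set PSL2 :=
  {h | (∃ x ∈ l, pslSMul h x = x) ∨ ∃ ξ, IsEndpoint l ξ ∧ HasNonrepelling h ξ}

/-- A general right AdS crooked plane: a set of the form `g·C*(l)`. -/
def IsRightCrookedPlane (S : Set PSL2) : Prop :=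
  ∃ (g : PSL2) (l : Set ℍ), IsGeodesicLine l ∧ S = (g * ·) '' rightCrooked l

/-- A general left AdS crooked plane: a set of the form `C(l)·g`. -/
def IsLeftCrookedPlane (S : Set PSL2) : Prop :=
  ∃ (g : PSL2) (l : Set ℍ), IsGeodesicLine l ∧ S = (· * g) '' leftCrooked l

variable {Γ : Type*} [Group Γ]

/-- The action `γ·x = ρ(γ) x j(γ)⁻¹` of `Γ` on `PSL(2,ℝ)`, applied to a set. -/
def actImg (j ρ : Γ →* PSL2) (γ : Γ) (S : Set PSL2) : Set PSL2 :=
  (fun x => ρ γ * x * (j γ)⁻¹) '' S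

/-- The action `γ·x = ρ(γ) x j(γ)⁻¹` is properly discontinuous. -/
def ProperlyDisc (j ρ : Γ →* PSL2) : Prop :=
  ∀ K : Set PSL2, IsCompact K → {γ : Γ | (actImg j ρ γ K ∩ K).Nonempty}.Finite

/-- `R` is a fundamental domain for the action `γ·x = ρ(γ) x j(γ)⁻¹`:
`R` is closed, its translates cover `PSL(2,ℝ)`, and the interiors of the
translates are pairwise disjoint. -/
def IsFundDom (j ρ : Γ →* PSL2) (R : Set PSL2) : Prop :=
  IsClosed R ∧ (⋃ γ : Γ, actImg j ρ γ R) = Set.univ ∧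
    Pairwise fun γ₁ γ₂ : Γ =>
      Disjoint (interior (actImg j ρ γ₁ R)) (interior (actImg j ρ γ₂ R))

/-- The action admits a fundamental domain bounded by pairwise disjoint
right AdS crooked planes. -/
def AdmitsRightCrookedFD (j ρ : Γ →* PSL2) : Prop :=
  ∃ (m : ℕ) (D : Fin m → Set PSL2), (∀ i, IsRightCrookedPlane (D i)) ∧
    (∀ (γ γ' : Γ) (i i' : Fin m),
      actImg j ρ γ (D i) = actImg j ρ γ' (D i') ∨
      Disjoint (actImg j ρ γ (D i)) (actImg j ρ γ' (D i'))) ∧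
    ∃ x ∈ (⋃ (γ : Γ) (i : Fin m), actImg j ρ γ (D i))ᶜ,
      IsFundDom j ρ
        (closure (connectedComponentIn (⋃ (γ : Γ) (i : Fin m), actImg j ρ γ (D i))ᶜ x))

/-- The action admits a fundamental domain bounded by pairwise disjoint
left AdS crooked planes. -/
def AdmitsLeftCrookedFD (j ρ : Γ →* PSL2) : Prop :=
  ∃ (m : ℕ) (D : Fin m → Set PSL2), (∀ i, IsLeftCrookedPlane (D i)) ∧
    (∀ (γ γ' : Γ) (i i' : Fin m),
      actImg j ρ γ (D i) = actImg j ρ γ' (D i') ∨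
      Disjoint (actImg j ρ γ (D i)) (actImg j ρ γ' (D i'))) ∧
    ∃ x ∈ (⋃ (γ : Γ) (i : Fin m), actImg j ρ γ (D i))ᶜ,
      IsFundDom j ρ
        (closure (connectedComponentIn (⋃ (γ : Γ) (i : Fin m), actImg j ρ γ (D i))ᶜ x))

/-- The translation length `λ(g) = inf_{p ∈ ℍ} d(p, g·p)`. -/
def transLength (g : PSL2) : ℝ := ⨅ p : ℍ, dist p (pslSMul g p)

/-- `U` is a connected component of `S`. -/
def IsCC (S U : Set ℍ) : Prop := ∃ x ∈ S, connectedComponentIn S x = U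

/-- `ξ ∈ ℝ ∪ {∞}` is an ideal point of `U ⊆ ℍ`: a limit of a sequence of points
of `U` in the one-point compactification of `ℂ`. -/
def IsIdealPoint (U : Set ℍ) (ξ : OnePoint ℝ) : Prop :=
  ∃ u : ℕ → ℍ, (∀ n, u n ∈ U) ∧ Tendsto (fun n => embH (u n)) atTop (𝓝 (toC ξ))

/-- The closed right crooked half-space `H̄*₊(l, U)`. -/
def closedRHS (l U : Set ℍ) : Set PSL2 :=
  {h | (∃ x ∈ l ∪ U, pslSMul h x = x) ∨ ∃ ξ, IsIdealPoint U ξ ∧ HasNonattracting h ξ}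

/-- The open right crooked half-space `H*₊(l, U)`. -/
def openRHS (l U : Set ℍ) : Set PSL2 :=
  {h | h ≠ 1 ∧ ((∃ x ∈ U, pslSMul h x = x) ∨
    ∃ ξ, IsIdealPoint U ξ ∧ ¬ IsEndpoint l ξ ∧ HasNonattracting h ξ)}

/-- The circle of (Euclidean) radius `c` in `ℍ` centered at `0`; for suitable `c`
this is a geodesic line of `ℍ`. -/
def circ (c : ℝ) : Set ℍ := {z : ℍ | ‖(z : ℂ)‖ = c}

/-- The stem quadrant `SQ(ℓ)` for `ℓ = {|z| = 1/R}` transversely oriented towards `0`. -/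
def SQell (R : ℝ) : Set PSL2 :=
  {h | ∃ (A : SL2) (α β v : ℝ), (QuotientGroup.mk A : PSL2) = h ∧
    (A : Matrix (Fin 2) (Fin 2) ℝ) = !![α, -v/R; v*R, β] ∧
    |α| < |β| ∧ 2*|v| < |α - β|}

/-- The inverse stem quadrant `SQ(ℓ')⁻¹` for `ℓ' = {|z| = R}` transversely
oriented towards `∞`. -/
def SQell'inv (R : ℝ) : Set PSL2 :=
  {h | ∃ (A : SL2) (α β v : ℝ), (QuotientGroup.mk A : PSL2) = h ∧
    (A : Matrix (Fin 2) (Fin 2) ℝ) = !![α, v*R; -v/R, β] ∧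
    |α| < |β| ∧ 2*|v| < |α - β|}

/-- The stem quadrant `SQ(ℓ')`. -/
def SQell' (R : ℝ) : Set PSL2 := {h | h⁻¹ ∈ SQell'inv R}

/-! ### Algebraic core -/

/-- The model crooked plane, for the imaginary axis. -/
def C0 : Set SL2 := {M | (∃ r : ℝ, 0 < r ∧ M 0 0 = M 1 1 ∧ M 0 1 = - r * M 1 0) ∨
  (M 1 0 = 0 ∧ |M 0 0| ≤ 1) ∨ (M 0 1 = 0 ∧ |M 1 1| ≤ 1)}

/-- The bilinear form giving the hyperbolic cosine of the distance. -/
def NN (P : SL2) (x y : ℝ) : ℝ := P 0 0 ^ 2 * y + P 0 1 ^ 2 + P 1 0 ^ 2 * (x * y) + P 1 1 ^ 2 * x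

lemma det_sl (P : SL2) : P 0 0 * P 1 1 - P 0 1 * P 1 0 = 1 := by
  have := P.det_coe
  rwa [Matrix.det_fin_two] at this

/-- Explicit element of `SL2`. -/
def mkSL (a b c d : ℝ) (h : a * d - b * c = 1) : SL2 :=
  ⟨!![a, b; c, d], by rw [Matrix.det_fin_two]; simpa using h⟩

@[simp] lemma mkSL_00 (a b c d : ℝ) (h) : (mkSL a b c d h) 0 0 = a := rfl
@[simp] lemma mkSL_01 (a b c d : ℝ) (h) : (mkSL a b c d h) 0 1 = b := rfl
@[simp] lemma mkSL_10 (a b c d : ℝ) (h) : (mkSL a b c d h) 1 0 = c := rfl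
@[simp] lemma mkSL_11 (a b c d : ℝ) (h) : (mkSL a b c d h) 1 1 = d := rfl

lemma sl_ext {A B : SL2} (h1 : A 0 0 = B 0 0) (h2 : A 0 1 = B 0 1) (h3 : A 1 0 = B 1 0)
    (h4 : A 1 1 = B 1 1) : A = B := by
  ext i j
  fin_cases i <;> fin_cases j <;> assumption

lemma mul_ent (A B : SL2) (i j : Fin 2) : (A * B) i j = A i 0 * B 0 j + A i 1 * B 1 j := by
  rw [Matrix.SpecialLinearGroup.coe_mul, Matrix.mul_apply, Fin.sum_univ_two]

lemma unit_rot (z w : ℂ) (h : Complex.normSq z = Complex.normSq w) :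
    ∃ t : ℝ, z = Complex.exp (t * Complex.I) * w := by
  have hn : ‖z‖ = ‖w‖ := by
    rw [Complex.norm_def, Complex.norm_def, h]
  refine ⟨z.arg - w.arg, ?_⟩
  have ez := Complex.norm_mul_exp_arg_mul_I z
  have ew := Complex.norm_mul_exp_arg_mul_I w
  have e : Complex.exp (((z.arg - w.arg : ℝ) : ℂ) * Complex.I) * Complex.exp (w.arg * Complex.I) =
      Complex.exp (z.arg * Complex.I) := by
    rw [← Complex.exp_add]
    congr 1
    push_cast
    ring
  calc z = ‖w‖ * Complex.exp (z.arg * Complex.I) := by rw [← hn, ez]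
    _ = Complex.exp (((z.arg - w.arg : ℝ) : ℂ) * Complex.I) *
        (‖w‖ * Complex.exp (w.arg * Complex.I)) := by rw [← e]; ring
    _ = _ := by rw [ew]

lemma rot_core (a b c d a' b' c' d' : ℝ) (hdet : a * d - b * c = a' * d' - b' * c')
    (hN : a ^ 2 + b ^ 2 + c ^ 2 + d ^ 2 = a' ^ 2 + b' ^ 2 + c' ^ 2 + d' ^ 2) :
    ∃ θ φ : ℝ,
      a * φ.cos + b * φ.sin = θ.cos * a' - θ.sin * c' ∧
      -a * φ.sin + b * φ.cos = θ.cos * b' - θ.sin * d' ∧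
      c * φ.cos + d * φ.sin = θ.sin * a' + θ.cos * c' ∧
      -c * φ.sin + d * φ.cos = θ.sin * b' + θ.cos * d' := by
  obtain ⟨s, hs⟩ := unit_rot ⟨a + d, c - b⟩ ⟨a' + d', c' - b'⟩ (by
    simp only [Complex.normSq_mk]; linarith)
  obtain ⟨t, ht⟩ := unit_rot ⟨a - d, c + b⟩ ⟨a' - d', c' + b'⟩ (by
    simp only [Complex.normSq_mk]; linarith)
  set θ := (s + t) / 2 with hθ
  set φ := (t - s) / 2 with hφ
  have e1 : (⟨a + d, c - b⟩ : ℂ) * Complex.exp (φ * Complex.I) =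
      Complex.exp (θ * Complex.I) * ⟨a' + d', c' - b'⟩ := by
    rw [hs, mul_right_comm, ← Complex.exp_add]
    congr 2
    rw [hθ, hφ]; push_cast; ring
  have e2 : (⟨a - d, c + b⟩ : ℂ) * Complex.exp ((-φ : ℝ) * Complex.I) =
      Complex.exp (θ * Complex.I) * ⟨a' - d', c' + b'⟩ := by
    rw [ht, mul_right_comm, ← Complex.exp_add]
    congr 2
    rw [hθ, hφ]; push_cast; ring
  have r1 := congrArg Complex.re e1
  have i1 := congrArg Complex.im e1
  have r2 := congrArg Complex.re e2
  have i2 := congrArg Complex.im e2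
  simp only [Complex.mul_re, Complex.mul_im, Complex.exp_ofReal_mul_I_re,
    Complex.exp_ofReal_mul_I_im, Real.cos_neg, Real.sin_neg] at r1 i1 r2 i2
  refine ⟨θ, φ, ?_, ?_, ?_, ?_⟩ <;> linarith

lemma interior_core (P Q : SL2) (x y : ℝ) (hx : 0 < x) (hy : 0 < y) (h : NN P x y = NN Q x y) :
    ∃ M M' : SL2, (M 0 0 = M 1 1 ∧ M 0 1 = - x * M 1 0) ∧
      (M' 0 0 = M' 1 1 ∧ M' 0 1 = - y * M' 1 0) ∧ P * M' = M * Q := by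
  obtain ⟨u, hu, rfl⟩ : ∃ u : ℝ, 0 < u ∧ x = u ^ 2 :=
    ⟨√x, Real.sqrt_pos.2 hx, (Real.sq_sqrt hx.le).symm⟩
  obtain ⟨v, hv, rfl⟩ : ∃ u : ℝ, 0 < u ∧ y = u ^ 2 :=
    ⟨√y, Real.sqrt_pos.2 hy, (Real.sq_sqrt hy.le).symm⟩
  have dP := det_sl P
  have dQ := det_sl Q
  obtain ⟨θ, φ, h1, h2, h3, h4⟩ := rot_core (P 0 0 * v) (P 0 1) (u * v * P 1 0) (u * P 1 1)
    (Q 0 0 * v) (Q 0 1) (u * v * Q 1 0) (u * Q 1 1)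
    (by linear_combination u * v * dP - u * v * dQ)
    (by unfold NN at h; linear_combination h)
  have s1 := Real.sin_sq_add_cos_sq θ
  have s2 := Real.sin_sq_add_cos_sq φ
  refine ⟨mkSL θ.cos (-u * θ.sin) (θ.sin / u) θ.cos ?_,
    mkSL φ.cos (-v * φ.sin) (φ.sin / v) φ.cos ?_, ?_, ?_, ?_⟩
  · field_simp; linarith
  · field_simp; linarith
  · simp; field_simp
  · simp; field_simp
  · apply sl_ext <;> simp only [mul_ent, mkSL_00, mkSL_01, mkSL_10, mkSL_11]
    · field_simp; linear_combination h1
    · field_simp; linear_combination h2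
    · field_simp; linear_combination h3
    · field_simp; linear_combination h4

lemma sq_le_one_of_abs {a : ℝ} (h : |a| ≤ 1) : a ^ 2 ≤ 1 := by
  rwa [sq_le_one_iff_abs_le_one]

lemma core_row (M Q : SL2) (hM : M ∈ C0) : ∃ α β : ℝ, 0 ≤ α ∧ 0 ≤ β ∧ 0 < α + β ∧
    ∀ j, α * Q 0 j ^ 2 + β * Q 1 j ^ 2 ≤ α * (M * Q) 0 j ^ 2 + β * (M * Q) 1 j ^ 2 := by
  have dM := det_sl M
  rcases hM with ⟨r, hr, h1, h2⟩ | ⟨h1, h2⟩ | ⟨h1, h2⟩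
  · refine ⟨1, r, zero_le_one, hr.le, by positivity, fun j => le_of_eq ?_⟩
    simp only [mul_ent]
    rw [h1, h2] at dM ⊢
    linear_combination (-Q 0 j ^ 2 - r * Q 1 j ^ 2) * dM
  · refine ⟨0, 1, le_rfl, zero_le_one, by norm_num, fun j => ?_⟩
    simp only [mul_ent, h1]
    rw [h1] at dM
    have := sq_le_one_of_abs h2
    have e : (M 0 0 ^ 2) * (M 1 1 ^ 2) = 1 := by
      have : M 0 0 * M 1 1 = 1 := by linarith
      rw [← mul_pow, this, one_pow]
    have : 1 ≤ M 1 1 ^ 2 := by nlinarith [sq_nonneg (M 1 1)]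
    nlinarith [sq_nonneg (Q 1 j)]
  · refine ⟨1, 0, zero_le_one, le_rfl, by norm_num, fun j => ?_⟩
    simp only [mul_ent, h1]
    rw [h1] at dM
    have := sq_le_one_of_abs h2
    have e : (M 0 0 ^ 2) * (M 1 1 ^ 2) = 1 := by
      have : M 0 0 * M 1 1 = 1 := by linarith
      rw [← mul_pow, this, one_pow]
    have : 1 ≤ M 0 0 ^ 2 := by nlinarith [sq_nonneg (M 0 0)]
    nlinarith [sq_nonneg (Q 0 j)]

lemma core_col (M P : SL2) (hM : M ∈ C0) : ∃ α β : ℝ, 0 ≤ α ∧ 0 ≤ β ∧ 0 < α + β ∧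
    ∀ j, α * (P * M) j 0 ^ 2 + β * (P * M) j 1 ^ 2 ≤ α * P j 0 ^ 2 + β * P j 1 ^ 2 := by
  have dM := det_sl M
  rcases hM with ⟨r, hr, h1, h2⟩ | ⟨h1, h2⟩ | ⟨h1, h2⟩
  · refine ⟨r, 1, hr.le, zero_le_one, by positivity, fun j => le_of_eq ?_⟩
    simp only [mul_ent]
    rw [h1, h2] at dM ⊢
    linear_combination (P j 1 ^ 2 + r * P j 0 ^ 2) * dM
  · refine ⟨1, 0, zero_le_one, le_rfl, by norm_num, fun j => ?_⟩
    simp only [mul_ent, h1]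
    have := sq_le_one_of_abs h2
    nlinarith [sq_nonneg (P j 0)]
  · refine ⟨0, 1, le_rfl, zero_le_one, by norm_num, fun j => ?_⟩
    simp only [mul_ent, h1]
    have := sq_le_one_of_abs h2
    nlinarith [sq_nonneg (P j 1)]

lemma core1 (P Q : SL2) (h : ∀ i j, P i j ^ 2 < Q i j ^ 2) (M M' : SL2) (hM : M ∈ C0)
    (hM' : M' ∈ C0) : P * M' ≠ M * Q := by
  intro he
  obtain ⟨a, b, ha, hb, hab, h1⟩ := core_row M Q hM
  obtain ⟨c, d, hc, hd, hcd, h2⟩ := core_col M' P hM'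
  rw [← he] at h1
  have k0 := mul_le_mul_of_nonneg_left (h1 0) hc
  have k1 := mul_le_mul_of_nonneg_left (h1 1) hd
  have l0 := mul_le_mul_of_nonneg_left (h2 0) ha
  have l1 := mul_le_mul_of_nonneg_left (h2 1) hb
  have t : a * c * (Q 0 0 ^ 2 - P 0 0 ^ 2) + a * d * (Q 0 1 ^ 2 - P 0 1 ^ 2) +
    b * c * (Q 1 0 ^ 2 - P 1 0 ^ 2) + b * d * (Q 1 1 ^ 2 - P 1 1 ^ 2) ≤ 0 := by linarith
  have p00 := sub_pos.2 (h 0 0)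
  have p01 := sub_pos.2 (h 0 1)
  have p10 := sub_pos.2 (h 1 0)
  have p11 := sub_pos.2 (h 1 1)
  have q00 := mul_nonneg (mul_nonneg ha hc) p00.le
  have q01 := mul_nonneg (mul_nonneg ha hd) p01.le
  have q10 := mul_nonneg (mul_nonneg hb hc) p10.le
  have q11 := mul_nonneg (mul_nonneg hb hd) p11.le
  rcases ha.eq_or_lt with ha0 | ha0
  · have hb0 : 0 < b := by linarith
    rcases hc.eq_or_lt with hc0 | hc0
    · have hd0 : 0 < d := by linarith
      have := mul_pos (mul_pos hb0 hd0) p11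
      linarith
    · have := mul_pos (mul_pos hb0 hc0) p10
      linarith
  · rcases hc.eq_or_lt with hc0 | hc0
    · have hd0 : 0 < d := by linarith
      have := mul_pos (mul_pos ha0 hd0) p01
      linarith
    · have := mul_pos (mul_pos ha0 hc0) p00
      linarith

/-- Absence of intersection, in the model. -/
def Dj (P Q : SL2) : Prop := ∀ M ∈ C0, ∀ M' ∈ C0, P * M' ≠ M * Q

/-- The rotation by a half-turn. -/
def SS : SL2 := mkSL 0 (-1) 1 0 (by norm_num)

lemma SSinv : SS⁻¹ = mkSL 0 1 (-1) 0 (by norm_num) := by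
  rw [inv_eq_iff_mul_eq_one]
  apply sl_ext <;> simp [mul_ent, SS]

lemma C0_conj (M : SL2) (hM : M ∈ C0) : SS * M * SS⁻¹ ∈ C0 ∧ SS⁻¹ * M * SS ∈ C0 := by
  rw [SSinv]
  constructor
  all_goals
    rcases hM with ⟨r, hr, h1, h2⟩ | ⟨h1, h2⟩ | ⟨h1, h2⟩
    · left
      refine ⟨1 / r, by positivity, ?_, ?_⟩
      · simp [mul_ent, SS, h1]
      · simp [mul_ent, SS, h2]; field_simp
    · right; right
      simp [mul_ent, SS, h1, h2]
    · right; left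
      simp [mul_ent, SS, h1, h2]

lemma Dj_left {P Q : SL2} (h : Dj P Q) : Dj (SS * P) (SS * Q) := by
  intro M hM M' hM' he
  refine h _ (C0_conj M hM).2 M' hM' ?_
  have : P * M' = SS⁻¹ * (SS * P * M') := by group
  rw [this, he]; group

lemma Dj_right {P Q : SL2} (h : Dj P Q) : Dj (P * SS) (Q * SS) := by
  intro M hM M' hM' he
  refine h _ hM _ (C0_conj M' hM').1 ?_
  have : P * (SS * M' * SS⁻¹) = (P * SS * M') * SS⁻¹ := by group
  rw [this, he]; group

lemma corner10 {P Q : SL2} (h : Dj P Q) : P 1 0 ^ 2 < Q 1 0 ^ 2 ∨ (Q 1 0 = 0 ∧ P 1 0 ≠ 0) := by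
  by_contra hcon
  push Not at hcon
  obtain ⟨h1, h2⟩ := hcon
  have dP := det_sl P
  have dQ := det_sl Q
  by_cases hq : Q 1 0 = 0
  · have hp := h2 hq
    rw [hq] at dQ
    rw [hp] at dP
    have hq0 : Q 0 0 ≠ 0 := by rintro h0; simp [h0] at dQ
    have hp0 : P 0 0 ≠ 0 := by rintro h0; simp [h0] at dP
    have hq11 : Q 1 1 = 1 / Q 0 0 := by field_simp; linarith
    have hp11 : P 1 1 = 1 / P 0 0 := by field_simp; linarith
    obtain ⟨e, he, he1, he2⟩ : ∃ e : ℝ, 0 < e ∧ e ≤ 1 ∧ |P 0 0 * e / Q 0 0| ≤ 1 := by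
      refine ⟨min 1 (|Q 0 0| / |P 0 0|), by positivity, min_le_left _ _, ?_⟩
      have hm : 0 < min 1 (|Q 0 0| / |P 0 0|) := by positivity
      have hP := abs_pos.2 hp0
      have hQ := abs_pos.2 hq0
      rw [abs_div, abs_mul, abs_of_pos hm, div_le_one hQ]
      have := min_le_right 1 (|Q 0 0| / |P 0 0|)
      rw [le_div_iff₀ hP] at this
      linarith
    refine h (mkSL (P 0 0 * e / Q 0 0) ((P 0 1 / e - P 0 0 * e / Q 0 0 * Q 0 1) * Q 0 0) 0
      (Q 0 0 / (P 0 0 * e)) (by field_simp; ring))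
      (Or.inr (Or.inl ⟨rfl, he2⟩)) (mkSL e 0 0 (1 / e) (by field_simp; ring))
      (Or.inr (Or.inl ⟨rfl, by rw [mkSL_00, abs_of_pos he]; exact he1⟩)) ?_
    apply sl_ext <;> simp only [mul_ent, mkSL_00, mkSL_01, mkSL_10, mkSL_11, hq, hp, hq11, hp11]
    · field_simp; ring
    · field_simp; ring
    · ring
    · field_simp; ring
  · have hq2 : 0 < Q 1 0 ^ 2 := by positivity
    have hp : P 1 0 ≠ 0 := by
      rintro h0; rw [h0] at h1; norm_num at h1; exact hq (by nlinarith)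
    refine h (mkSL (Q 1 0 / P 1 0) ((P 0 0 - Q 1 0 / P 1 0 * Q 0 0) / Q 1 0) 0 (P 1 0 / Q 1 0)
      (by field_simp; ring)) (Or.inr (Or.inl ⟨rfl, ?_⟩))
      (mkSL 1 ((P 1 0 / Q 1 0 * Q 1 1 - P 1 1) / P 1 0) 0 1 (by ring))
      (Or.inr (Or.inl ⟨rfl, by simp⟩)) ?_
    · rw [mkSL_00, ← sq_le_one_iff_abs_le_one, div_pow, div_le_one (by positivity)]
      exact h1
    · apply sl_ext <;> simp only [mul_ent, mkSL_00, mkSL_01, mkSL_10, mkSL_11]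
      · field_simp; ring
      · field_simp; linear_combination (Q 1 0) * dQ - (Q 1 0) * dP
      · field_simp; ring
      · field_simp; ring

lemma corner {P Q : SL2} (h : Dj P Q) (i j : Fin 2) :
    P i j ^ 2 < Q i j ^ 2 ∨ (Q i j = 0 ∧ P i j ≠ 0) := by
  fin_cases i <;> fin_cases j
  · have := corner10 (Dj_left h)
    simpa [mul_ent, SS] using this
  · have := corner10 (Dj_left (Dj_right h))
    simpa [mul_ent, SS] using this
  · exact corner10 h
  · have := corner10 (Dj_right h)
    simpa [mul_ent, SS] using this

lemma form_nonpos_b (a b c d : ℝ)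
    (h : ∀ x y : ℝ, 0 < x → 0 < y → a * y + b + c * (x * y) + d * x ≤ 0) : b ≤ 0 := by
  have ht : Tendsto (fun t : ℝ => a * t + b + c * (t * t) + d * t) (𝓝[>] 0) (𝓝 b) := by
    have : Continuous (fun t : ℝ => a * t + b + c * (t * t) + d * t) := by fun_prop
    have := this.tendsto 0
    simp only [mul_zero, zero_add, add_zero] at this
    exact this.mono_left nhdsWithin_le_nhds
  refine le_of_tendsto ht ?_
  filter_upwards [self_mem_nhdsWithin] with t ht
  exact h t t ht ht

lemma form_nonpos (a b c d : ℝ)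
    (h : ∀ x y : ℝ, 0 < x → 0 < y → a * y + b + c * (x * y) + d * x ≤ 0) :
    a ≤ 0 ∧ b ≤ 0 ∧ c ≤ 0 ∧ d ≤ 0 := by
  have hy : ∀ a b c d : ℝ,
      (∀ x y : ℝ, 0 < x → 0 < y → a * y + b + c * (x * y) + d * x ≤ 0) →
      ∀ x y : ℝ, 0 < x → 0 < y → b * y + a + d * (x * y) + c * x ≤ 0 := by
    intro a b c d h x y hx hy
    have := mul_nonpos_of_nonneg_of_nonpos hy.le (h x y⁻¹ hx (inv_pos.2 hy))
    have e : y * (a * y⁻¹ + b + c * (x * y⁻¹) + d * x) = b * y + a + d * (x * y) + c * x := by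
      field_simp; ring
    linarith
  have hx : ∀ a b c d : ℝ,
      (∀ x y : ℝ, 0 < x → 0 < y → a * y + b + c * (x * y) + d * x ≤ 0) →
      ∀ x y : ℝ, 0 < x → 0 < y → c * y + d + a * (x * y) + b * x ≤ 0 := by
    intro a b c d h x y hx hy
    have := mul_nonpos_of_nonneg_of_nonpos hx.le (h x⁻¹ y (inv_pos.2 hx) hy)
    have e : x * (a * y + b + c * (x⁻¹ * y) + d * x⁻¹) = c * y + d + a * (x * y) + b * x := by
      field_simp; ring
    linarith
  exact ⟨form_nonpos_b _ _ _ _ (hy _ _ _ _ h), form_nonpos_b _ _ _ _ h,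
    form_nonpos_b _ _ _ _ (hx _ _ _ _ (hy _ _ _ _ h)), form_nonpos_b _ _ _ _ (hx _ _ _ _ h)⟩

lemma NN_le_imp (P Q : SL2) (c : ℝ) (h : ∀ x y : ℝ, 0 < x → 0 < y → NN P x y ≤ c * NN Q x y)
    (i j : Fin 2) : P i j ^ 2 ≤ c * Q i j ^ 2 := by
  obtain ⟨h1, h2, h3, h4⟩ := form_nonpos (P 0 0 ^ 2 - c * Q 0 0 ^ 2) (P 0 1 ^ 2 - c * Q 0 1 ^ 2)
    (P 1 0 ^ 2 - c * Q 1 0 ^ 2) (P 1 1 ^ 2 - c * Q 1 1 ^ 2) (fun x y hx hy => by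
      have := h x y hx hy
      unfold NN at this
      linarith)
  fin_cases i <;> fin_cases j <;> simp <;> linarith

lemma core2 {P Q : SL2} (h : Dj P Q) (i j : Fin 2) : P i j ^ 2 < Q i j ^ 2 := by
  by_contra hbad
  have hbad' : Q i j ^ 2 < P i j ^ 2 := by
    rcases corner h i j with h1 | ⟨h1, h2⟩
    · exact absurd h1 hbad
    · rw [h1, zero_pow two_ne_zero]; positivity
  -- a good entry exists
  obtain ⟨k, m, hgood⟩ : ∃ k m, P k m ^ 2 < Q k m ^ 2 := by
    by_contra hno
    push Not at hno
    have hz : ∀ k m, Q k m = 0 := fun k m => by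
      rcases corner h k m with h1 | h1
      · exact absurd h1 (not_lt.2 (hno k m))
      · exact h1.1
    have := det_sl Q
    simp [hz] at this
  obtain ⟨x1, y1, hx1, hy1, h1⟩ : ∃ x y : ℝ, 0 < x ∧ 0 < y ∧ NN Q x y < NN P x y := by
    by_contra hno
    push Not at hno
    have := NN_le_imp P Q 1 (by simpa using hno) i j
    linarith
  obtain ⟨x2, y2, hx2, hy2, h2⟩ : ∃ x y : ℝ, 0 < x ∧ 0 < y ∧ NN P x y < NN Q x y := by
    by_contra hno
    push Not at hno
    have := NN_le_imp Q P 1 (by simpa using hno) k m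
    linarith
  have hconv : IsPreconnected (Set.Ioi (0 : ℝ) ×ˢ Set.Ioi (0 : ℝ)) :=
    isPreconnected_Ioi.prod isPreconnected_Ioi
  have hc1 : Continuous (fun p : ℝ × ℝ => NN P p.1 p.2) := by unfold NN; fun_prop
  have hc2 : Continuous (fun p : ℝ × ℝ => NN Q p.1 p.2) := by unfold NN; fun_prop
  obtain ⟨⟨x, y⟩, ⟨hx, hy⟩, he⟩ := hconv.intermediate_value₂ (a := (x2, y2)) (b := (x1, y1))
    ⟨hx2, hy2⟩ ⟨hx1, hy1⟩ hc1.continuousOn hc2.continuousOn h2.le h1.le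
  obtain ⟨M, M', hM, hM', hPQ⟩ := interior_core P Q x y hx hy he
  exact h M (Or.inl ⟨x, hx, hM⟩) M' (Or.inl ⟨y, hy, hM'⟩) hPQ

lemma NN_lower (P : SL2) (x y t : ℝ) (hx : 0 < x) (hy : 0 < y) (ht : 0 < t) (h : x * y = t ^ 2) :
    2 * t ≤ NN P x y := by
  obtain ⟨u, hu, rfl⟩ : ∃ u : ℝ, 0 < u ∧ x = u ^ 2 :=
    ⟨√x, Real.sqrt_pos.2 hx, (Real.sq_sqrt hx.le).symm⟩
  obtain ⟨v, hv, rfl⟩ : ∃ u : ℝ, 0 < u ∧ y = u ^ 2 :=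
    ⟨√y, Real.sqrt_pos.2 hy, (Real.sq_sqrt hy.le).symm⟩
  have e : t = u * v := by
    rw [← mul_pow] at h
    exact ((pow_left_inj₀ (by positivity) ht.le two_ne_zero).1 h).symm
  have dP := det_sl P
  have : NN P (u ^ 2) (v ^ 2) = (P 0 0 * v - P 1 1 * u) ^ 2 + (P 0 1 + P 1 0 * (u * v)) ^ 2 +
      2 * (u * v) * (P 0 0 * P 1 1 - P 0 1 * P 1 0) := by unfold NN; ring
  rw [this, dP, e]
  nlinarith [sq_nonneg (P 0 0 * v - P 1 1 * u), sq_nonneg (P 0 1 + P 1 0 * (u * v))]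

lemma Q_ne_zero (P Q : SL2) (c : ℝ) (hc0 : 0 < c) (hc : c < 1)
    (h : ∀ x y : ℝ, 0 < x → 0 < y → NN P x y ≤ c * NN Q x y) (i j : Fin 2) : Q i j ≠ 0 := by
  intro hq
  have dQ := det_sl Q
  have key : ∀ x y t : ℝ, 0 < x → 0 < y → 0 < t → x * y = t ^ 2 → 2 * t ≤ c * NN Q x y :=
    fun x y t hx hy ht e => (NN_lower P x y t hx hy ht e).trans (h x y hx hy)
  have h1c : 0 < 1 - c := by linarith
  unfold NN at key
  have hcase : (Q 0 1 * Q 1 0 = 0 ∧ Q 0 0 * Q 1 1 = 1) ∨ (Q 0 0 * Q 1 1 = 0 ∧ Q 0 1 * Q 1 0 = -1) := by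
    fin_cases i <;> fin_cases j <;> simp at hq <;> simp [hq] at dQ ⊢ <;> linarith
  rcases hcase with ⟨h0, h1⟩ | ⟨h0, h1⟩
  · have hA : 0 < Q 0 0 ^ 2 := by
      have : Q 0 0 ≠ 0 := by rintro h'; simp [h'] at h1
      positivity
    have hD : 0 < Q 1 1 ^ 2 := by
      have : Q 1 1 ≠ 0 := by rintro h'; simp [h'] at h1
      positivity
    have hAD : Q 0 0 ^ 2 * Q 1 1 ^ 2 = 1 := by rw [← mul_pow, h1, one_pow]
    have key2 : ∀ t : ℝ, 0 < t → 2 * t ≤ c * (2 * t + Q 0 1 ^ 2 + Q 1 0 ^ 2 * t ^ 2) := by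
      intro t ht
      have := key (Q 0 0 ^ 2 * t) (Q 1 1 ^ 2 * t) t (by positivity) (by positivity) ht
        (by linear_combination t ^ 2 * hAD)
      convert this using 2
      linear_combination (- 2 * t - Q 1 0 ^ 2 * t ^ 2) * hAD
    rcases mul_eq_zero.1 h0 with hz | hz
    · have := key2 ((1 - c) / (Q 1 0 ^ 2 + 1)) (by positivity)
      rw [hz] at this
      set t := (1 - c) / (Q 1 0 ^ 2 + 1) with ht
      have ht0 : 0 < t := by positivity
      have e : t * (Q 1 0 ^ 2 + 1) = 1 - c := by rw [ht]; field_simp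
      have : t * (2 * (1 - c)) ≤ t * (c * (t * Q 1 0 ^ 2)) := by linarith
      have := le_of_mul_le_mul_left this ht0
      have h3 : t * Q 1 0 ^ 2 ≤ 1 - c := by linarith
      have h4 : c * (t * Q 1 0 ^ 2) ≤ c * (1 - c) := by gcongr
      nlinarith
    · have := key2 ((Q 0 1 ^ 2 + 1) / (2 * (1 - c))) (by positivity)
      rw [hz] at this
      set t := (Q 0 1 ^ 2 + 1) / (2 * (1 - c)) with ht
      have e : 2 * t * (1 - c) = Q 0 1 ^ 2 + 1 := by rw [ht]; field_simp
      nlinarith [sq_nonneg (Q 0 1)]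
  · have hA : 0 < Q 0 1 ^ 2 := by
      have : Q 0 1 ≠ 0 := by rintro h'; simp [h'] at h1
      positivity
    have hAD : Q 0 1 ^ 2 * Q 1 0 ^ 2 = 1 := by rw [← mul_pow, h1]; norm_num
    set B := Q 0 1 ^ 2 with hB
    -- x * y = B ^ 2
    have key2 : ∀ x : ℝ, 0 < x → 2 * B ≤ c * (2 * B + Q 0 0 ^ 2 * (B ^ 2 / x) + Q 1 1 ^ 2 * x) := by
      intro x hx
      have := key x (B ^ 2 / x) B hx (by positivity) hA (by field_simp)
      convert this using 2
      field_simp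
      linear_combination (- B * x) * hAD
    rcases mul_eq_zero.1 h0 with hz | hz
    · have := key2 (B * (1 - c) / (Q 1 1 ^ 2 + 1)) (by positivity)
      rw [hz] at this
      set t := B * (1 - c) / (Q 1 1 ^ 2 + 1) with ht
      have ht0 : 0 < t := by positivity
      have e : t * (Q 1 1 ^ 2 + 1) = B * (1 - c) := by rw [ht]; field_simp
      have h3 : t * Q 1 1 ^ 2 ≤ B * (1 - c) := by linarith
      have h4 : c * (t * Q 1 1 ^ 2) ≤ 1 * (t * Q 1 1 ^ 2) := by gcongr
      have h5 : 0 < B * (1 - c) := by positivity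
      nlinarith
    · have := key2 (B ^ 2 / (B * (1 - c) / (Q 0 0 ^ 2 + 1))) (by positivity)
      rw [hz] at this
      set t := B * (1 - c) / (Q 0 0 ^ 2 + 1) with ht
      have ht0 : 0 < t := by positivity
      have e : t * (Q 0 0 ^ 2 + 1) = B * (1 - c) := by rw [ht]; field_simp
      have e2 : B ^ 2 / (B ^ 2 / t) = t := by field_simp
      rw [e2] at this
      have h3 : t * Q 0 0 ^ 2 ≤ B * (1 - c) := by linarith
      have h4 : c * (t * Q 0 0 ^ 2) ≤ 1 * (t * Q 0 0 ^ 2) := by gcongr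
      have h5 : 0 < B * (1 - c) := by positivity
      nlinarith

lemma NN_iff (P Q : SL2) : (∃ c : ℝ, 0 < c ∧ c < 1 ∧
    ∀ x y : ℝ, 0 < x → 0 < y → NN P x y ≤ c * NN Q x y) ↔ ∀ i j, P i j ^ 2 < Q i j ^ 2 := by
  constructor
  · rintro ⟨c, hc0, hc, h⟩ i j
    have h1 := NN_le_imp P Q c h i j
    have h2 := Q_ne_zero P Q c hc0 hc h i j
    have : 0 < Q i j ^ 2 := by positivity
    nlinarith
  · intro h
    have hpos : ∀ i j, 0 < Q i j ^ 2 := fun i j => lt_of_le_of_lt (sq_nonneg _) (h i j)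
    have hex : ∀ i j, ∃ c : ℝ, 0 < c ∧ c < 1 ∧ P i j ^ 2 ≤ c * Q i j ^ 2 := by
      intro i j
      refine ⟨(P i j ^ 2 / Q i j ^ 2 + 1) / 2, ?_, ?_, ?_⟩
      · have := hpos i j; positivity
      · have := (div_lt_one (hpos i j)).2 (h i j); linarith
      · have e : P i j ^ 2 / Q i j ^ 2 * Q i j ^ 2 = P i j ^ 2 := div_mul_cancel₀ _ (hpos i j).ne'
        have := h i j
        linarith
    choose c hc0 hc1 hc2 using hex
    refine ⟨max (max (c 0 0) (c 0 1)) (max (c 1 0) (c 1 1)), ?_, ?_, ?_⟩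
    · exact lt_of_lt_of_le (hc0 0 0) ((le_max_left _ _).trans (le_max_left _ _))
    · simp [hc1]
    · intro x y hx hy
      set C := max (max (c 0 0) (c 0 1)) (max (c 1 0) (c 1 1)) with hC
      have l00 : c 0 0 ≤ C := (le_max_left _ _).trans (le_max_left _ _)
      have l01 : c 0 1 ≤ C := (le_max_right _ _).trans (le_max_left _ _)
      have l10 : c 1 0 ≤ C := (le_max_left _ _).trans (le_max_right _ _)
      have l11 : c 1 1 ≤ C := (le_max_right _ _).trans (le_max_right _ _)
      have up : ∀ i j, c i j ≤ C → P i j ^ 2 ≤ C * Q i j ^ 2 := fun i j hh =>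
        (hc2 i j).trans (mul_le_mul_of_nonneg_right hh (sq_nonneg _))
      unfold NN
      have a1 := mul_le_mul_of_nonneg_right (up 0 0 l00) hy.le
      have a2 := up 0 1 l01
      have a3 := mul_le_mul_of_nonneg_right (up 1 0 l10) (mul_pos hx hy).le
      have a4 := mul_le_mul_of_nonneg_right (up 1 1 l11) hx.le
      linarith

/-! ### Geometry -/

/-- The parametrized imaginary axis. -/
def ax (t : ℝ) : ℍ := ⟨⟨0, Real.exp t⟩, Real.exp_pos t⟩

lemma ax_re (t : ℝ) : (ax t).re = 0 := rfl
lemma ax_im (t : ℝ) : (ax t).im = Real.exp t := rfl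
lemma ax_coe (t : ℝ) : (ax t : ℂ) = Real.exp t * Complex.I := by
  apply Complex.ext <;> simp [ax_re, ax_im, ← Complex.ofReal_exp, -Complex.ofReal_exp]

lemma ax_zero : ax 0 = UpperHalfPlane.I := by
  apply UpperHalfPlane.ext
  rw [ax_coe]; simp

lemma sl_coe (A : SL2) (z : ℍ) :
    ((A • z : ℍ) : ℂ) = (A 0 0 * z + A 0 1) / (A 1 0 * z + A 1 1) := by
  rw [UpperHalfPlane.coe_specialLinearGroup_apply]; rfl

lemma sl_den (A : SL2) (z : ℍ) : (A 1 0 * z + A 1 1 : ℂ) ≠ 0 := by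
  intro h
  have h1 := congrArg Complex.im h
  have h2 := congrArg Complex.re h
  simp at h1 h2
  have hz := z.im_pos.ne'
  have dA := det_sl A
  rcases h1 with h1 | h1
  · rw [h1] at h2 dA; simp at h2; rw [h2] at dA; simp at dA
  · exact hz h1

lemma den_pos (A : SL2) (v : ℝ) (hv : 0 < v) : 0 < A 1 0 ^ 2 * v ^ 2 + A 1 1 ^ 2 := by
  have dA := det_sl A
  by_cases h : A 1 1 = 0
  · have : A 1 0 ≠ 0 := by rintro h0; simp [h, h0] at dA
    positivity
  · positivity

lemma sl_ax (A : SL2) (t : ℝ) :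
    (A • ax t).re = (A 0 0 * A 1 0 * Real.exp t ^ 2 + A 0 1 * A 1 1) /
      (A 1 0 ^ 2 * Real.exp t ^ 2 + A 1 1 ^ 2) ∧
    (A • ax t).im = Real.exp t / (A 1 0 ^ 2 * Real.exp t ^ 2 + A 1 1 ^ 2) := by
  have hD := den_pos A _ (Real.exp_pos t)
  have dA := det_sl A
  have h := sl_coe A (ax t)
  rw [eq_div_iff (sl_den A _), ax_coe] at h
  have h1 := congrArg Complex.re h
  have h2 := congrArg Complex.im h
  simp only [Complex.mul_re, Complex.mul_im, Complex.add_re, Complex.add_im, Complex.ofReal_re,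
    Complex.ofReal_im, Complex.I_re, Complex.I_im, UpperHalfPlane.coe_re,
    UpperHalfPlane.coe_im] at h1 h2
  ring_nf at h1 h2
  constructor
  · rw [eq_div_iff hD.ne']
    linear_combination A 1 1 * h1 + A 1 0 * Real.exp t * h2
  · rw [eq_div_iff hD.ne']
    linear_combination A 1 1 * h2 - A 1 0 * Real.exp t * h1 + Real.exp t * dA

lemma cosh_ax (P : SL2) (s t : ℝ) :
    2 * (Real.exp s * Real.exp t) * Real.cosh (dist (ax s) (P • ax t)) =
      NN P (Real.exp s ^ 2) (Real.exp t ^ 2) := by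
  obtain ⟨h1, h2⟩ := sl_ax P t
  have hD := den_pos P _ (Real.exp_pos t)
  have dP := det_sl P
  rw [UpperHalfPlane.cosh_dist', h1, h2, ax_re, ax_im]
  have hs := Real.exp_pos s
  have ht := Real.exp_pos t
  set u := Real.exp s
  set v := Real.exp t
  set D := P 1 0 ^ 2 * v ^ 2 + P 1 1 ^ 2 with hDdef
  have e : (P 0 0 * P 1 0 * v ^ 2 + P 0 1 * P 1 1) ^ 2 + v ^ 2 =
      (P 0 0 ^ 2 * v ^ 2 + P 0 1 ^ 2) * D := by
    rw [hDdef]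
    linear_combination (-v ^ 2) * (P 0 0 * P 1 1 - P 0 1 * P 1 0 + 1) * dP
  have e2 : NN P (u ^ 2) (v ^ 2) = P 0 0 ^ 2 * v ^ 2 + P 0 1 ^ 2 + u ^ 2 * D := by
    rw [hDdef, NN]; ring
  rw [e2]
  field_simp
  linear_combination e

lemma fix_ax (M : SL2) (t : ℝ) :
    M • ax t = ax t ↔ M 0 0 = M 1 1 ∧ M 0 1 = - (Real.exp t ^ 2) * M 1 0 := by
  have ht := Real.exp_pos t
  rw [UpperHalfPlane.ext_iff, sl_coe, div_eq_iff (sl_den M _), ax_coe, Complex.ext_iff]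
  simp only [Complex.mul_re, Complex.mul_im, Complex.add_re, Complex.add_im, Complex.ofReal_re,
    Complex.ofReal_im, Complex.I_re, Complex.I_im]
  ring_nf
  constructor
  · rintro ⟨h1, h2⟩
    exact ⟨mul_right_cancel₀ ht.ne' (by linarith), by linarith⟩
  · rintro ⟨h1, h2⟩
    rw [h1, h2]
    constructor <;> ring

lemma isometry_ax : Isometry ax := UpperHalfPlane.isometry_vertical_line 0

lemma dist_ax (s t : ℝ) : dist (ax s) (ax t) = |s - t| := by
  rw [isometry_ax.dist_eq, Real.dist_eq]

lemma cosh_inj {a b : ℝ} (ha : 0 ≤ a) (hb : 0 ≤ b) (h : Real.cosh a = Real.cosh b) : a = b := by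
  have := Real.cosh_abs a ▸ Real.cosh_abs b ▸ h
  apply le_antisymm
  · have := Real.cosh_le_cosh.1 h.le; rwa [abs_of_nonneg ha, abs_of_nonneg hb] at this
  · have := Real.cosh_le_cosh.1 h.ge; rwa [abs_of_nonneg ha, abs_of_nonneg hb] at this

/-- Points are determined by their distances to two points of the axis. -/
lemma eq_ax (z : ℍ) (t : ℝ) (h0 : dist (ax 0) z = |t|) (h1 : dist (ax 1) z = |t - 1|) :
    z = ax t := by
  have c0 : Real.cosh (dist (ax 0) z) = Real.cosh t := by rw [h0, Real.cosh_abs]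
  have c1 : Real.cosh (dist (ax 1) z) = Real.cosh (t - 1) := by rw [h1, Real.cosh_abs]
  rw [UpperHalfPlane.cosh_dist', ax_re, ax_im, Real.cosh_eq] at c0 c1
  rw [Real.exp_zero] at c0
  have e1 : Real.exp (t - 1) = Real.exp t / Real.exp 1 := Real.exp_sub _ _
  have e2 : Real.exp (-(t - 1)) = Real.exp 1 / Real.exp t := by rw [neg_sub, Real.exp_sub]
  rw [e1, e2] at c1
  rw [Real.exp_neg] at c0
  have hE : 1 < Real.exp 1 := by simp
  have hT := Real.exp_pos t
  have hz := z.im_pos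
  set E := Real.exp 1
  set T := Real.exp t
  have hE0 : 0 < E := by linarith
  field_simp at c0 c1
  have him : z.im = T := by
    have : (E ^ 2 - 1) * (z.im - T) = 0 := by linear_combination c0 - c1
    rcases mul_eq_zero.1 this with h | h
    · nlinarith
    · linarith
  have hre : z.re = 0 := by
    rw [him] at c0
    have : z.re ^ 2 * T = 0 := by linear_combination c0
    have := (mul_eq_zero.1 this).resolve_right hT.ne'
    exact pow_eq_zero_iff two_ne_zero |>.1 this
  exact UpperHalfPlane.ext_re_im (by rw [hre, ax_re]) (by rw [him, ax_im])

lemma geod (γ : ℝ → ℍ) (hγ : Isometry γ) : ∃ A : SL2, ∀ t, γ t = A • ax t := by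
  obtain ⟨A, hA⟩ := MulAction.exists_smul_eq SL2 (ax 0) (γ 0)
  obtain ⟨Q, hQ⟩ := MulAction.exists_smul_eq SL2 (ax 0) (A⁻¹ • γ 1)
  obtain ⟨P, hP⟩ := MulAction.exists_smul_eq SL2 (ax 0) (ax 1)
  have hd : dist (ax 0) (Q • ax 0) = dist (ax 0) (P • ax 0) := by
    rw [hQ, hP, ← dist_smul A, smul_inv_smul, hA, hγ.dist_eq, isometry_ax.dist_eq]
  have hN : NN P (Real.exp 0 ^ 2) (Real.exp 0 ^ 2) = NN Q (Real.exp 0 ^ 2) (Real.exp 0 ^ 2) := by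
    rw [← cosh_ax, ← cosh_ax, hd]
  obtain ⟨R, R', hR, hR', he⟩ := interior_core P Q _ _ (by positivity) (by positivity) hN
  rw [← fix_ax] at hR hR'
  have hR1 : R • (A⁻¹ • γ 1) = ax 1 := by
    rw [← hQ, smul_smul, ← he, ← smul_smul, hR', hP]
  have hR0 : R • (A⁻¹ • γ 0) = ax 0 := by
    rw [← hA, inv_smul_smul, hR]
  refine ⟨A * R⁻¹, fun t => ?_⟩
  have : R • (A⁻¹ • γ t) = ax t := by
    apply eq_ax
    · rw [← hR0, dist_smul, dist_smul, hγ.dist_eq, Real.dist_eq, zero_sub, abs_neg]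
    · rw [← hR1, dist_smul, dist_smul, hγ.dist_eq, Real.dist_eq, abs_sub_comm]
  rw [← this, ← smul_smul, inv_smul_smul, smul_inv_smul]

lemma real_isom (σ : ℝ → ℝ) (h : Isometry σ) : (∀ t, σ t = t + σ 0) ∨ ∀ t, σ t = -t + σ 0 := by
  have d0 : ∀ t, (σ t - σ 0) ^ 2 = t ^ 2 := fun t => by
    have := h.dist_eq t 0
    rw [Real.dist_eq, Real.dist_eq, sub_zero] at this
    rw [← sq_abs, this, sq_abs]
  have d1 : ∀ t, (σ t - σ 1) ^ 2 = (t - 1) ^ 2 := fun t => by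
    have := h.dist_eq t 1
    rw [Real.dist_eq, Real.dist_eq] at this
    rw [← sq_abs, this, sq_abs]
  have h1 : σ 1 - σ 0 = 1 ∨ σ 1 - σ 0 = -1 := by
    have := d0 1
    rw [one_pow] at this
    exact sq_eq_sq_iff_eq_or_eq_neg.1 (by rw [this, one_pow])
  rcases h1 with h1 | h1
  · left; intro t
    have e : σ 1 = σ 0 + 1 := by linarith
    have a := d0 t
    have b := d1 t
    rw [e] at b
    nlinarith
  · right; intro t
    have e : σ 1 = σ 0 - 1 := by linarith
    have a := d0 t
    have b := d1 t
    rw [e] at b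
    nlinarith

/-- The geodesic line attached to `A`. -/
def Lin (A : SL2) : Set ℍ := Set.range fun t => A • ax t

lemma geod_line (l : Set ℍ) (hl : IsGeodesicLine l) : ∃ A : SL2, l = Lin A := by
  obtain ⟨γ, hγ, rfl⟩ := hl
  obtain ⟨A, hA⟩ := geod γ hγ
  exact ⟨A, by rw [Lin, funext hA]⟩

/-- `ξ` is the `j`-th endpoint of the line attached to `A`. -/
def par (A : SL2) (j : Fin 2) (ξ : OnePoint ℝ) : Prop :=
  bvec ξ 0 * A 1 j = bvec ξ 1 * A 0 j

lemma bvec_infty : bvec OnePoint.infty = ![1, 0] := rfl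
lemma bvec_coe (r : ℝ) : bvec (r : OnePoint ℝ) = ![r, 1] := rfl

lemma col_ne (A : SL2) (j : Fin 2) (h0 : A 0 j = 0) (h1 : A 1 j = 0) : False := by
  have := det_sl A
  fin_cases j <;> simp at h0 h1 <;> simp [h0, h1] at this

lemma par_scale (A : SL2) (j : Fin 2) (ξ : OnePoint ℝ) (h : par A j ξ) :
    ∃ k : ℝ, k ≠ 0 ∧ ∀ i, bvec ξ i = k * A i j := by
  unfold par at h
  induction ξ using OnePoint.rec with
  | infty =>
    rw [bvec_infty] at *
    simp at h
    have : A 0 j ≠ 0 := fun h0 => col_ne A j h0 h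
    refine ⟨1 / A 0 j, by positivity, fun i => ?_⟩
    fin_cases i
    · simp [this]
    · simp [h]
  | coe r =>
    rw [bvec_coe] at *
    simp at h
    have : A 1 j ≠ 0 := fun h0 => col_ne A j (by rw [← h, h0, mul_zero]) h0
    refine ⟨1 / A 1 j, by positivity, fun i => ?_⟩
    fin_cases i
    · simp [← h]; field_simp
    · simp [this]

lemma par_exists (A : SL2) (j : Fin 2) : ∃ ξ, par A j ξ := by
  unfold par
  by_cases h : A 1 j = 0
  · exact ⟨OnePoint.infty, by rw [bvec_infty]; simp [h]⟩
  · exact ⟨((A 0 j / A 1 j : ℝ) : OnePoint ℝ), by rw [bvec_coe]; simp [h]⟩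

lemma toC_inj {ξ η : OnePoint ℝ} (h : toC ξ = toC η) : ξ = η := by
  exact (Option.map_injective Complex.ofReal_injective) h

lemma lim0 (A : SL2) (ξ : OnePoint ℝ) (h : par A 0 ξ) :
    Tendsto (fun t => embH (A • ax t)) atTop (𝓝 (toC ξ)) := by
  unfold par at h
  have dA := det_sl A
  induction ξ using OnePoint.rec with
  | infty =>
    rw [bvec_infty] at h
    simp at h
    have h1 : toC OnePoint.infty = OnePoint.infty := rfl
    rw [h1]
    have hd : A 1 1 ≠ 0 := by rintro h0; simp [h, h0] at dA
    have hd2 : 0 < A 1 1 ^ 2 := by positivity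
    refine OnePoint.tendsto_coe_infty.comp (f := fun t => ((A • ax t : ℍ) : ℂ)) ?_
    rw [Filter.coclosedCompact_eq_cocompact, ← Metric.cobounded_eq_cocompact, ← tendsto_norm_atTop_iff_cobounded]
    refine tendsto_atTop_mono (f := fun t => Real.exp t / A 1 1 ^ 2) (fun t => ?_)
      (Real.tendsto_exp_atTop.atTop_div_const hd2)
    have := (sl_ax A t).2
    rw [h] at this
    norm_num at this
    rw [← this]
    exact (le_abs_self _).trans (Complex.abs_im_le_norm _)
  | coe r =>
    rw [bvec_coe] at h
    simp at h
    have h1 : toC (r : OnePoint ℝ) = ((r : ℂ) : OnePoint ℂ) := rfl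
    rw [h1]
    have hc : A 1 0 ≠ 0 := by rintro h0; simp [← h, h0] at dA
    refine (OnePoint.continuous_coe.tendsto (r : ℂ)).comp (f := fun t => ((A • ax t : ℍ) : ℂ)) ?_
    have e : ∀ t, ((A • ax t : ℍ) : ℂ) =
        (A 0 0 + A 0 1 * (ax t : ℂ)⁻¹) / (A 1 0 + A 1 1 * (ax t : ℂ)⁻¹) := by
      intro t
      rw [sl_coe, ← mul_div_mul_right _ _ (inv_ne_zero (ax t).ne_zero)]
      have := (ax t).ne_zero
      congr 1 <;> field_simp
    have hi : Tendsto (fun t => (ax t : ℂ)⁻¹) atTop (𝓝 0) := by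
      rw [tendsto_zero_iff_norm_tendsto_zero]
      have : ∀ t, ‖(ax t : ℂ)⁻¹‖ = Real.exp (-t) := by
        intro t
        rw [ax_coe, norm_inv, norm_mul, Complex.norm_I, mul_one, Complex.norm_real,
          Real.norm_of_nonneg (Real.exp_pos t).le, Real.exp_neg]
      simp_rw [this]
      exact Real.tendsto_exp_neg_atTop_nhds_zero
    have hr : (r : ℂ) = (A 0 0 + A 0 1 * 0) / (A 1 0 + A 1 1 * 0) := by
      rw [mul_zero, mul_zero, add_zero, add_zero, ← h]
      have : (A 1 0 : ℂ) ≠ 0 := by exact_mod_cast hc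
      push_cast
      field_simp
    simp_rw [e]
    rw [hr]
    refine Tendsto.div (tendsto_const_nhds.add (tendsto_const_nhds.mul hi))
      (tendsto_const_nhds.add (tendsto_const_nhds.mul hi)) ?_
    simpa using hc

lemma SS_ax (t : ℝ) : SS • ax t = ax (-t) := by
  apply UpperHalfPlane.ext
  rw [sl_coe, ax_coe, ax_coe]
  have : (Real.exp t : ℂ) ≠ 0 := by exact_mod_cast (Real.exp_pos t).ne'
  simp only [SS, mkSL_00, mkSL_01, mkSL_10, mkSL_11, Real.exp_neg]
  push_cast
  rw [div_eq_iff (by simp)]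
  field_simp
  have hI := Complex.I_sq
  push_cast
  linear_combination (-Complex.exp t) * hI

lemma par_SS (A : SL2) (ξ : OnePoint ℝ) : par (A * SS) 0 ξ ↔ par A 1 ξ := by
  unfold par
  simp [mul_ent, SS]

lemma lim1 (A : SL2) (ξ : OnePoint ℝ) (h : par A 1 ξ) :
    Tendsto (fun t => embH (A • ax (-t))) atTop (𝓝 (toC ξ)) := by
  have := lim0 (A * SS) ξ ((par_SS A ξ).2 h)
  simpa only [← smul_smul, SS_ax] using this

lemma isometry_par (A : SL2) : Isometry fun t => A • ax t :=
  (isometry_smul ℍ A).comp isometry_ax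

lemma endpoint_iff (A : SL2) (ξ : OnePoint ℝ) :
    IsEndpoint (Lin A) ξ ↔ par A 0 ξ ∨ par A 1 ξ := by
  constructor
  · rintro ⟨γ, hγ, hr, ht⟩
    have hσ : ∀ t, ∃ s, A • ax s = γ t := fun t => by
      have : γ t ∈ Lin A := hr ▸ Set.mem_range_self t
      exact this
    choose σ hσ using hσ
    have hiso : Isometry σ := Isometry.of_dist_eq fun s t => by
      rw [← (isometry_par A).dist_eq]
      simp only [hσ]
      exact hγ.dist_eq _ _
    simp_rw [← hσ] at ht
    rcases real_isom σ hiso with h | h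
    · left
      obtain ⟨η, hη⟩ := par_exists A 0
      have h2 := (lim0 A η hη).comp (tendsto_atTop_add_const_right atTop (σ 0) tendsto_id)
      have : (fun t => embH (A • ax (σ t))) = (fun t => embH (A • ax t)) ∘ fun t => id t + σ 0 := by
        funext t; simp [h t]
      rw [this] at ht
      rw [toC_inj (tendsto_nhds_unique ht h2)]
      exact hη
    · right
      obtain ⟨η, hη⟩ := par_exists A 1
      have h2 := (lim1 A η hη).comp (tendsto_atTop_add_const_right atTop (-σ 0) tendsto_id)
      have : (fun t => embH (A • ax (σ t))) =
          (fun t => embH (A • ax (-t))) ∘ fun t => id t + -σ 0 := by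
        funext t; simp [h t, add_comm]
      rw [this] at ht
      rw [toC_inj (tendsto_nhds_unique ht h2)]
      exact hη
  · rintro (h | h)
    · exact ⟨_, isometry_par A, rfl, lim0 A ξ h⟩
    · refine ⟨fun t => A • ax (-t), ?_, ?_, lim1 A ξ h⟩
      · exact (isometry_par A).comp (IsometryEquiv.neg ℝ).isometry
      · exact (Equiv.neg ℝ).surjective.range_comp (fun t => A • ax t)

lemma center_form {Z : SL2} (hZ : Z ∈ Subgroup.center SL2) :
    ∃ r : ℝ, r ^ 2 = 1 ∧ Z 0 0 = r ∧ Z 0 1 = 0 ∧ Z 1 0 = 0 ∧ Z 1 1 = r := by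
  obtain ⟨r, hr, h⟩ := Matrix.SpecialLinearGroup.mem_center_iff.1 hZ
  refine ⟨r, by simpa using hr, ?_⟩
  rw [← h]
  simp

lemma center_smul {Z : SL2} (hZ : Z ∈ Subgroup.center SL2) (z : ℍ) : Z • z = z := by
  obtain ⟨r, hr, h1, h2, h3, h4⟩ := center_form hZ
  have hr0 : (r : ℂ) ≠ 0 := by
    intro h0
    have : r = 0 := by exact_mod_cast h0
    rw [this] at hr; norm_num at hr
  apply UpperHalfPlane.ext
  rw [sl_coe, h1, h2, h3, h4]
  simp
  field_simp

lemma psl_mk (H : SL2) (z : ℍ) : pslSMul (QuotientGroup.mk H) z = H • z := by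
  unfold pslSMul
  obtain ⟨Z, hZ⟩ := QuotientGroup.mk_out_eq_mul (Subgroup.center SL2) H
  have : (Quotient.out (QuotientGroup.mk H : PSL2)) = H * (Z : SL2) := hZ
  rw [this, ← smul_smul, center_smul Z.2]

lemma C0_center {M Z : SL2} (hM : M ∈ C0) (hZ : Z ∈ Subgroup.center SL2) : M * Z ∈ C0 := by
  obtain ⟨r, hr, h1, h2, h3, h4⟩ := center_form hZ
  have hr1 : |r| = 1 := by
    have : r = 1 ∨ r = -1 := sq_eq_sq_iff_eq_or_eq_neg.1 (by rw [hr, one_pow])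
    rcases this with h | h <;> simp [h]
  rcases hM with ⟨q, hq, k1, k2⟩ | ⟨k1, k2⟩ | ⟨k1, k2⟩
  · left
    refine ⟨q, hq, ?_, ?_⟩
    · simp [mul_ent, h1, h2, h3, h4, k1]
    · simp [mul_ent, h1, h2, h3, h4, k2]; ring
  · right; left
    simp [mul_ent, h1, h3, k1, hr1, abs_mul, k2]
  · right; right
    simp [mul_ent, h2, h4, k1, hr1, abs_mul, k2]

lemma eig_iff (A M H : SL2) (hH : H * A = A * M) (j : Fin 2) (ξ : OnePoint ℝ) (h : par A j ξ)
    (μ : ℝ) : (H : Matrix (Fin 2) (Fin 2) ℝ).mulVec (bvec ξ) = μ • bvec ξ ↔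
      ∀ i, A i 0 * M 0 j + A i 1 * M 1 j = μ * A i j := by
  obtain ⟨k, hk, hb⟩ := par_scale A j ξ h
  rw [funext_iff]
  refine forall_congr' fun i => ?_
  rw [Matrix.mulVec, dotProduct, Fin.sum_univ_two, Pi.smul_apply, smul_eq_mul, hb, hb, hb]
  have e := congrArg (fun X : SL2 => X i j) hH
  simp only [mul_ent] at e
  rw [← e]
  constructor
  · intro h'
    apply mul_left_cancel₀ hk
    linear_combination h'
  · intro h'
    linear_combination k * h'

lemma eig0 (A M : SL2) (μ : ℝ) :
    (∀ i, A i 0 * M 0 0 + A i 1 * M 1 0 = μ * A i 0) ↔ M 0 0 = μ ∧ M 1 0 = 0 := by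
  have dA := det_sl A
  constructor
  · intro h
    have h0 := h 0
    have h1 := h 1
    constructor
    · linear_combination (μ - M 0 0) * dA + A 1 1 * h0 - A 0 1 * h1
    · linear_combination (- M 1 0) * dA + A 0 0 * h1 - A 1 0 * h0
  · rintro ⟨h1, h2⟩ i
    rw [h1, h2]; ring

lemma eig1 (A M : SL2) (μ : ℝ) :
    (∀ i, A i 0 * M 0 1 + A i 1 * M 1 1 = μ * A i 1) ↔ M 1 1 = μ ∧ M 0 1 = 0 := by
  have dA := det_sl A
  constructor
  · intro h
    have h0 := h 0
    have h1 := h 1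
    constructor
    · linear_combination (μ - M 1 1) * dA + A 0 0 * h1 - A 1 0 * h0
    · linear_combination (- M 0 1) * dA + A 1 1 * h0 - A 0 1 * h1
  · rintro ⟨h1, h2⟩ i
    rw [h1, h2]; ring

lemma crooked_iff (A : SL2) (h : PSL2) :
    h ∈ rightCrooked (Lin A) ↔ ∃ M ∈ C0, h = QuotientGroup.mk (A * M * A⁻¹) := by
  constructor
  · rintro (⟨x, ⟨t, rfl⟩, hx⟩ | ⟨ξ, hξ, H, rfl, μ, hμ, hv⟩)
    · obtain ⟨H, rfl⟩ := QuotientGroup.mk_surjective h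
      refine ⟨A⁻¹ * H * A, Or.inl ⟨Real.exp t ^ 2, by positivity, ?_⟩, by congr 1; group⟩
      rw [← fix_ax]
      rw [psl_mk] at hx
      simp only at hx
      rw [← smul_smul, ← smul_smul, hx, inv_smul_smul]
    · have hH : H * A = A * (A⁻¹ * H * A) := by group
      refine ⟨A⁻¹ * H * A, ?_, by congr 1; group⟩
      rcases (endpoint_iff A ξ).1 hξ with hp | hp
      · rw [eig_iff A _ H hH _ _ hp, eig0] at hv
        exact Or.inr (Or.inl ⟨hv.2, by rw [hv.1]; exact hμ⟩)
      · rw [eig_iff A _ H hH _ _ hp, eig1] at hv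
        exact Or.inr (Or.inr ⟨hv.2, by rw [hv.1]; exact hμ⟩)
  · rintro ⟨M, hM, rfl⟩
    have hH : A * M * A⁻¹ * A = A * M := by group
    rcases hM with ⟨r, hr, hM⟩ | ⟨h1, h2⟩ | ⟨h1, h2⟩
    · left
      refine ⟨A • ax (Real.log r / 2), ⟨_, rfl⟩, ?_⟩
      have : M • ax (Real.log r / 2) = ax (Real.log r / 2) := by
        rw [fix_ax, ← Real.exp_nat_mul]
        have : ((2 : ℕ) : ℝ) * (Real.log r / 2) = Real.log r := by push_cast; ring
        rw [this, Real.exp_log hr]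
        exact hM
      rw [psl_mk, smul_smul, hH, ← smul_smul, this]
    · right
      obtain ⟨ξ, hξ⟩ := par_exists A 0
      refine ⟨ξ, (endpoint_iff A ξ).2 (Or.inl hξ), _, rfl, M 0 0, h2, ?_⟩
      rw [eig_iff A M _ hH _ _ hξ, eig0]
      exact ⟨rfl, h1⟩
    · right
      obtain ⟨ξ, hξ⟩ := par_exists A 1
      refine ⟨ξ, (endpoint_iff A ξ).2 (Or.inr hξ), _, rfl, M 1 1, h2, ?_⟩
      rw [eig_iff A M _ hH _ _ hξ, eig1]
      exact ⟨rfl, h1⟩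

lemma disj_iff (A A' G G' : SL2) :
    Disjoint (((QuotientGroup.mk G : PSL2) * ·) '' rightCrooked (Lin A))
      (((QuotientGroup.mk G' : PSL2) * ·) '' rightCrooked (Lin A')) ↔
    Dj ((G * A)⁻¹ * (G' * A')) (A⁻¹ * A') := by
  rw [Set.disjoint_left]
  constructor
  · intro h M hM M' hM' he
    refine h ⟨_, (crooked_iff A _).2 ⟨M, hM, rfl⟩, rfl⟩
      ⟨_, (crooked_iff A' _).2 ⟨M', hM', rfl⟩, ?_⟩
    simp only [← QuotientGroup.mk_mul]
    congr 1
    have : G' * (A' * M' * A'⁻¹) = G * A * ((G * A)⁻¹ * (G' * A') * M') * A'⁻¹ := by group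
    rw [this, he]; group
  · rintro h x ⟨k, hk, rfl⟩ ⟨k', hk', he⟩
    obtain ⟨M, hM, rfl⟩ := (crooked_iff A _).1 hk
    obtain ⟨M', hM', rfl⟩ := (crooked_iff A' _).1 hk'
    simp only [← QuotientGroup.mk_mul] at he
    rw [eq_comm, QuotientGroup.eq] at he
    set Z := (G * (A * M * A⁻¹))⁻¹ * (G' * (A' * M' * A'⁻¹)) with hZ
    refine h (M * Z) (C0_center hM he) M' hM' ?_
    have hc : Z * A = A * Z := (Subgroup.mem_center_iff.1 he A).symm
    have e1 : (G * A)⁻¹ * (G' * A') * M' = M * (A⁻¹ * Z) * A' := by rw [hZ]; group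
    have e2 : A⁻¹ * Z = Z * A⁻¹ := by
      rw [inv_mul_eq_iff_eq_mul, ← mul_assoc, ← hc]; group
    rw [e1, e2]; group

lemma metric_iff (P Q : SL2) :
    (∃ K > 0, ∀ s t, dist (ax s) (P • ax t) ≤ dist (ax s) (Q • ax t) - K) ↔
    ∃ c : ℝ, 0 < c ∧ c < 1 ∧ ∀ x y : ℝ, 0 < x → 0 < y → NN P x y ≤ c * NN Q x y := by
  have toNN : ∀ c : ℝ, (∀ x y : ℝ, 0 < x → 0 < y → NN P x y ≤ c * NN Q x y) ↔
      ∀ s t, Real.cosh (dist (ax s) (P • ax t)) ≤ c * Real.cosh (dist (ax s) (Q • ax t)) := by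
    intro c
    constructor
    · intro h s t
      have hp : 0 < 2 * (Real.exp s * Real.exp t) := by positivity
      have := h (Real.exp s ^ 2) (Real.exp t ^ 2) (by positivity) (by positivity)
      rw [← cosh_ax, ← cosh_ax] at this
      refine le_of_mul_le_mul_left ?_ hp
      linarith
    · intro h x y hx hy
      have key : ∀ r : ℝ, 0 < r → Real.exp (Real.log r / 2) ^ 2 = r := fun r hr => by
        rw [← Real.exp_nat_mul]
        have : ((2 : ℕ) : ℝ) * (Real.log r / 2) = Real.log r := by push_cast; ring
        rw [this, Real.exp_log hr]
      have := h (Real.log x / 2) (Real.log y / 2)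
      rw [← key x hx, ← key y hy, ← cosh_ax, ← cosh_ax]
      have hp : 0 < 2 * (Real.exp (Real.log x / 2) * Real.exp (Real.log y / 2)) := by positivity
      have := mul_le_mul_of_nonneg_left this hp.le
      linarith
  constructor
  · rintro ⟨K, hK, h⟩
    have hcK : 1 < Real.cosh K := Real.one_lt_cosh.2 hK.ne'
    refine ⟨1 / Real.cosh K, by positivity, by rw [div_lt_one (by positivity)]; exact hcK, ?_⟩
    rw [toNN]
    intro s t
    have h1 := h s t
    set p := dist (ax s) (P • ax t)
    set q := dist (ax s) (Q • ax t)
    have hp : 0 ≤ p := dist_nonneg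
    have h2 : Real.cosh p ≤ Real.cosh (q - K) := by
      rw [Real.cosh_le_cosh, abs_of_nonneg hp]
      exact h1.trans (le_abs_self _)
    -- `cosh q = cosh (q-K) cosh K + sinh (q-K) sinh K`
    have h3 : Real.cosh q = Real.cosh (q - K) * Real.cosh K + Real.sinh (q - K) * Real.sinh K := by
      rw [← Real.cosh_add, sub_add_cancel]
    have h4 : 0 ≤ Real.sinh (q - K) := Real.sinh_nonneg_iff.2 (by linarith)
    have h5 : 0 ≤ Real.sinh K := Real.sinh_nonneg_iff.2 hK.le
    have h6 := mul_nonneg h4 h5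
    rw [div_mul_eq_mul_div, one_mul, le_div_iff₀ (by positivity)]
    have := mul_le_mul_of_nonneg_right h2 (by positivity : 0 ≤ Real.cosh K)
    linarith
  · rintro ⟨c, hc0, hc1, h⟩
    rw [toNN] at h
    have hK : 0 < -Real.log c := by have := Real.log_neg hc0 hc1; linarith
    refine ⟨-Real.log c, hK, fun s t => ?_⟩
    have h1 := h s t
    set p := dist (ax s) (P • ax t)
    set q := dist (ax s) (Q • ax t)
    have hp : 0 ≤ p := dist_nonneg
    have hq : 0 ≤ q := dist_nonneg
    set K := -Real.log c with hKdef
    have hexp : Real.exp (-K) = c := by rw [hKdef, neg_neg, Real.exp_log hc0]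
    have hexp' : Real.exp K = c⁻¹ := by rw [hKdef, Real.exp_neg, Real.exp_log hc0]
    have hKq : K ≤ q := by
      have a1 : Real.cosh K ≤ Real.cosh q := by
        have a2 : 1 ≤ c * Real.cosh q := (Real.one_le_cosh p).trans h1
        have a3 : Real.cosh K ≤ c⁻¹ := by
          rw [Real.cosh_eq, hexp, hexp']
          have : 1 ≤ c⁻¹ := (one_le_inv₀ hc0).2 hc1.le
          linarith
        refine a3.trans ?_
        rw [inv_eq_one_div, div_le_iff₀ hc0]
        linarith
      rwa [Real.cosh_le_cosh, abs_of_nonneg hK.le, abs_of_nonneg hq] at a1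
    have h2 : c * Real.cosh q ≤ Real.cosh (q - K) := by
      rw [Real.cosh_sub, ← hexp, Real.exp_neg, ← Real.exp_neg, ← Real.cosh_sub_sinh]
      have a1 : Real.sinh q ≤ Real.cosh q := (Real.sinh_lt_cosh q).le
      have a2 : 0 ≤ Real.sinh K := Real.sinh_nonneg_iff.2 hK.le
      have := mul_le_mul_of_nonneg_right a1 a2
      linarith
    have h3 := h1.trans h2
    rwa [Real.cosh_le_cosh, abs_of_nonneg hp, abs_of_nonneg (by linarith)] at h3

lemma main_iff (A A' G G' : SL2) :
    Disjoint (((QuotientGroup.mk G : PSL2) * ·) '' rightCrooked (Lin A))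
      (((QuotientGroup.mk G' : PSL2) * ·) '' rightCrooked (Lin A')) ↔
    ∃ K > 0, ∀ x ∈ Lin A, ∀ x' ∈ Lin A',
      dist (pslSMul (QuotientGroup.mk G) x) (pslSMul (QuotientGroup.mk G') x') ≤ dist x x' - K := by
  have hm : (∃ K > 0, ∀ x ∈ Lin A, ∀ x' ∈ Lin A',
      dist (pslSMul (QuotientGroup.mk G) x) (pslSMul (QuotientGroup.mk G') x') ≤ dist x x' - K) ↔
      ∃ K > 0, ∀ s t, dist (ax s) (((G * A)⁻¹ * (G' * A')) • ax t) ≤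
        dist (ax s) ((A⁻¹ * A') • ax t) - K := by
    refine exists_congr fun K => and_congr_right fun _ => ?_
    have e1 : ∀ s t, dist (ax s) (((G * A)⁻¹ * (G' * A')) • ax t) =
        dist (pslSMul (QuotientGroup.mk G) (A • ax s))
          (pslSMul (QuotientGroup.mk G') (A' • ax t)) := fun s t => by
      rw [psl_mk, psl_mk, smul_smul, smul_smul, ← dist_smul (G * A) (ax s), smul_smul,
        mul_inv_cancel_left]
    have e2 : ∀ s t, dist (ax s) ((A⁻¹ * A') • ax t) = dist (A • ax s) (A' • ax t) := fun s t => by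
      rw [← dist_smul A (ax s), smul_smul, mul_inv_cancel_left]
    simp only [e1, e2, Lin, Set.forall_mem_range]
  rw [hm, metric_iff, NN_iff, disj_iff]
  exact ⟨fun h => core2 h, fun h M hM M' hM' => core1 _ _ h M M' hM hM'⟩

theorem stmt3 (l l' : Set ℍ) (hl : IsGeodesicLine l) (hl' : IsGeodesicLine l')
    (g g' : PSL2) :
    Disjoint ((g * ·) '' rightCrooked l) ((g' * ·) '' rightCrooked l') ↔
      ∃ K > 0, ∀ x ∈ l, ∀ x' ∈ l',
        dist (pslSMul g x) (pslSMul g' x') ≤ dist x x' - K := by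
  obtain ⟨A, rfl⟩ := geod_line l hl
  obtain ⟨A', rfl⟩ := geod_line l' hl'
  obtain ⟨G, rfl⟩ := QuotientGroup.mk_surjective g
  obtain ⟨G', rfl⟩ := QuotientGroup.mk_surjective g'
  exact main_iff A A' G G'

end
end

section
/- Let γ, γ' : ℝ → ℍ be isometric embeddings whose images are geodesic lines ℓ, ℓ' of ℍ, and let ξ_ε = lim_{t→ε∞} γ(t) ∈ ℝ ∪ {∞} and ξ'_{ε'} = lim_{t→ε'∞} γ'(t) ∈ ℝ ∪ {∞} for ε, ε' ∈ {+,−} (limits in the one-point compactification of ℂ). Let g, g' ∈ PSL(2,ℝ). Then the following are equivalent: (i) there exists K > 0 such that d(g·γ(s), g'·γ'(t)) ≤ d(γ(s), γ'(t)) − K for all s, t ∈ ℝ; (ii) for every (ε, ε') ∈ {+,−}², one has ξ_ε ≠ ξ'_{ε'} and limsup over (s,t) → (ε∞, ε'∞) of d(g·γ(s), g'·γ'(t)) − d(γ(s), γ'(t)) is strictly negative. -/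
noncomputable section

open Filter Topology Pointwise
open scoped UpperHalfPlane

variable {Γ : Type*} [Group Γ]

namespace Stmt4Aux

/-- Hyperboloid coordinates of a point of `ℍ`. -/
def X (z : ℍ) : ℝ × ℝ × ℝ := ((z.re ^ 2 + z.im ^ 2) / z.im, z.re / z.im, 1 / z.im)

/-- Lorentzian form. -/
def B (u v : ℝ × ℝ × ℝ) : ℝ := (u.1 * v.2.2 + u.2.2 * v.1) / 2 - u.2.1 * v.2.1

lemma cosh_dist_eq (z w : ℍ) : Real.cosh (dist z w) = B (X z) (X w) := by
  rw [UpperHalfPlane.cosh_dist']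
  have := z.im_pos.ne'
  have := w.im_pos.ne'
  simp only [B, X]
  field_simp
  ring

lemma null_orth {D : ℝ × ℝ × ℝ} {z : ℍ} (h1 : B D D = 0) (h2 : B D (X z) = 0) : D = 0 := by
  obtain ⟨p, q, r⟩ := D
  have hy := z.im_pos
  have hy' := hy.ne'
  simp only [B, X] at h1 h2
  have h3 : p * r = q ^ 2 := by linarith
  have h4 : p + r * (z.re ^ 2 + z.im ^ 2) = 2 * q * z.re := by
    field_simp at h2
    linarith
  have h5 : (p - r * (z.re ^ 2 + z.im ^ 2)) ^ 2 + 4 * (q * z.im) ^ 2 = 0 := by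
    have : (p + r * (z.re ^ 2 + z.im ^ 2)) ^ 2 = (2 * q * z.re) ^ 2 := by rw [h4]
    linear_combination this - 4 * (z.re ^ 2 + z.im ^ 2) * h3
  have h6 : q * z.im = 0 := by
    have := sq_nonneg (p - r * (z.re ^ 2 + z.im ^ 2))
    have := sq_nonneg (q * z.im)
    exact pow_eq_zero_iff (two_ne_zero) |>.1 (by linarith)
  have hq : q = 0 := by simpa [hy'] using h6
  subst hq
  have h7 : p = r * (z.re ^ 2 + z.im ^ 2) := by
    have : (p - r * (z.re ^ 2 + z.im ^ 2)) ^ 2 = 0 := by nlinarith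
    have := pow_eq_zero_iff (two_ne_zero) |>.1 this
    linarith
  have h8 : p = 0 := by linarith
  have h9 : r = 0 := by
    rw [h8] at h7
    have : z.re ^ 2 + z.im ^ 2 ≠ 0 := by positivity
    rcases mul_eq_zero.1 h7.symm with h | h
    · exact h
    · exact absurd h this
  simp [h8, h9]

/-- Data representing a geodesic in the hyperboloid model. -/
structure Rep (γ : ℝ → ℍ) (U V : ℝ × ℝ × ℝ) : Prop where
  eq : ∀ t, X (γ t) = Real.exp t • U + Real.exp (-t) • V
  uu : B U U = 0
  vv : B V V = 0
  uv : B U V = 1 / 2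
  up : 0 ≤ U.1
  ur : 0 ≤ U.2.2
  vp : 0 ≤ V.1
  vr : 0 ≤ V.2.2

lemma B_comm (u v : ℝ × ℝ × ℝ) : B u v = B v u := by simp only [B]; ring

lemma Rep.symm {γ : ℝ → ℍ} {U V : ℝ × ℝ × ℝ} (h : Rep γ U V) : Rep (fun t => γ (-t)) V U where
  eq t := by rw [h.eq, neg_neg, add_comm]
  uu := h.vv
  vv := h.uu
  uv := by rw [B_comm]; exact h.uv
  up := h.vp
  ur := h.vr
  vp := h.up
  vr := h.ur

lemma lim_exp (a b : ℝ) :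
    Tendsto (fun t : ℝ => Real.exp (-t) * (Real.exp t * a + Real.exp (-t) * b)) atTop (𝓝 a) := by
  have h1 : Tendsto (fun t : ℝ => Real.exp (-t)) atTop (𝓝 0) := Real.tendsto_exp_neg_atTop_nhds_zero
  have h2 : Tendsto (fun t : ℝ => a + Real.exp (-t) * Real.exp (-t) * b) atTop (𝓝 (a + 0 * 0 * b)) :=
    ((h1.mul h1).mul_const b).const_add a
  have h3 : a + 0 * 0 * b = a := by ring
  rw [h3] at h2
  refine h2.congr fun t => ?_
  have : Real.exp (-t) * Real.exp t = 1 := by rw [← Real.exp_add]; simp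
  linear_combination -a * this

lemma nonneg_of {a b : ℝ} (h : ∀ t : ℝ, 0 ≤ Real.exp t * a + Real.exp (-t) * b) : 0 ≤ a :=
  ge_of_tendsto' (lim_exp a b) fun t => mul_nonneg (Real.exp_pos _).le (h t)

lemma exists_rep {γ : ℝ → ℍ} (hγ : Isometry γ) : ∃ U V, Rep γ U V := by
  have hB : ∀ s t, B (X (γ s)) (X (γ t)) = (Real.exp (s - t) + Real.exp (t - s)) / 2 := by
    intro s t
    rw [← cosh_dist_eq, hγ.dist_eq, Real.dist_eq, Real.cosh_abs, Real.cosh_eq]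
    simp
  set e := Real.exp 1 with he
  have he0 : 0 < e := Real.exp_pos _
  have he1 : 1 < e := by rw [he]; exact Real.one_lt_exp_iff.2 one_pos
  have hk : e ^ 2 - 1 ≠ 0 := by nlinarith
  set X0 := X (γ 0) with hX0
  set X1 := X (γ 1) with hX1
  have b00 : B X0 X0 = 1 := by rw [hB]; simp
  have b11 : B X1 X1 = 1 := by rw [hB]; simp
  have b01 : B X0 X1 = (e + e⁻¹) / 2 := by
    rw [hB]; simp only [zero_sub, sub_zero, Real.exp_neg, ← he]; ring
  have b0 : ∀ t, B (X (γ t)) X0 = (Real.exp t + (Real.exp t)⁻¹) / 2 := by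
    intro t; rw [hB]; simp only [zero_sub, sub_zero, Real.exp_neg]
  have b1 : ∀ t, B (X (γ t)) X1 = (Real.exp t / e + e / Real.exp t) / 2 := by
    intro t; rw [hB]; simp only [Real.exp_sub, ← he]
  let U : ℝ × ℝ × ℝ := (e / (e ^ 2 - 1)) • X1 - (1 / (e ^ 2 - 1)) • X0
  let V : ℝ × ℝ × ℝ := (e ^ 2 / (e ^ 2 - 1)) • X0 - (e / (e ^ 2 - 1)) • X1
  have bil : ∀ (a b c d : ℝ), B (a • X0 + b • X1) (c • X0 + d • X1)
      = a * c * B X0 X0 + (a * d + b * c) * B X0 X1 + b * d * B X1 X1 := by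
    intro a b c d
    simp only [B, Prod.fst_add, Prod.snd_add, Prod.smul_fst, Prod.smul_snd, smul_eq_mul]
    ring
  have hU : U = (-(1 / (e ^ 2 - 1))) • X0 + (e / (e ^ 2 - 1)) • X1 := by
    simp only [U, neg_smul]; abel
  have hV : V = (e ^ 2 / (e ^ 2 - 1)) • X0 + (-(e / (e ^ 2 - 1))) • X1 := by
    simp only [V, neg_smul]; abel
  have uu : B U U = 0 := by
    rw [hU, bil, b00, b11, b01]; field_simp; ring
  have vv : B V V = 0 := by
    rw [hV, bil, b00, b11, b01]; field_simp; ring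
  have uv : B U V = 1 / 2 := by
    rw [hU, hV, bil, b00, b11, b01]; field_simp; ring
  have bl : ∀ (Y : ℝ × ℝ × ℝ) (a b : ℝ), B Y (a • X0 + b • X1) = a * B Y X0 + b * B Y X1 := by
    intro Y a b
    simp only [B, Prod.fst_add, Prod.snd_add, Prod.smul_fst, Prod.smul_snd, smul_eq_mul]
    ring
  have xu : ∀ t, B (X (γ t)) U = (Real.exp t)⁻¹ / 2 := by
    intro t
    have := (Real.exp_pos t).ne'
    rw [hU, bl, b0, b1]; field_simp; ring
  have xv : ∀ t, B (X (γ t)) V = Real.exp t / 2 := by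
    intro t
    have := (Real.exp_pos t).ne'
    rw [hV, bl, b0, b1]; field_simp; ring
  have heq : ∀ t, X (γ t) = Real.exp t • U + Real.exp (-t) • V := by
    intro t
    have hE := (Real.exp_pos t).ne'
    rw [Real.exp_neg]
    rw [← sub_eq_zero]
    have u0 : B X0 U = 1 / 2 := by rw [hX0, xu]; simp
    have v0 : B X0 V = 1 / 2 := by rw [hX0, xv]; simp
    apply null_orth (z := γ 0)
    · have : ∀ (Y : ℝ × ℝ × ℝ) (a b : ℝ), B (Y - (a • U + b • V)) (Y - (a • U + b • V))
          = B Y Y - 2 * a * B Y U - 2 * b * B Y V + a ^ 2 * B U U + 2 * a * b * B U V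
            + b ^ 2 * B V V := by
        intro Y a b
        simp only [B, Prod.fst_add, Prod.snd_add, Prod.fst_sub, Prod.snd_sub, Prod.smul_fst,
          Prod.smul_snd, smul_eq_mul]
        ring
      rw [this, xu, xv, uu, uv, vv, hB]
      simp only [sub_self, Real.exp_zero]
      field_simp
      ring
    · have : ∀ (Y : ℝ × ℝ × ℝ) (a b : ℝ), B (Y - (a • U + b • V)) X0
          = B Y X0 - a * B X0 U - b * B X0 V := by
        intro Y a b
        simp only [B, Prod.fst_add, Prod.snd_add, Prod.fst_sub, Prod.snd_sub, Prod.smul_fst,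
          Prod.smul_snd, smul_eq_mul]
        ring
      rw [this, b0, u0, v0]
      ring
  have hp : ∀ t, 0 ≤ Real.exp t * U.1 + Real.exp (-t) * V.1 := by
    intro t
    have := congrArg (fun v : ℝ × ℝ × ℝ => v.1) (heq t)
    simp only [Prod.fst_add, Prod.smul_fst, smul_eq_mul] at this
    rw [← this]
    have := (γ t).im_pos
    simp only [X]; positivity
  have hr : ∀ t, 0 ≤ Real.exp t * U.2.2 + Real.exp (-t) * V.2.2 := by
    intro t
    have := congrArg (fun v : ℝ × ℝ × ℝ => v.2.2) (heq t)
    simp only [Prod.snd_add, Prod.smul_snd, smul_eq_mul] at this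
    rw [← this]
    have := (γ t).im_pos
    simp only [X]; positivity
  refine ⟨U, V, heq, uu, vv, uv, nonneg_of hp, nonneg_of hr, nonneg_of (b := U.1) fun t => ?_,
    nonneg_of (b := U.2.2) fun t => ?_⟩
  · have := hp (-t); rw [neg_neg] at this; linarith
  · have := hr (-t); rw [neg_neg] at this; linarith

/-- Boundary point of a null vector. -/
def pt (U : ℝ × ℝ × ℝ) : OnePoint ℝ :=
  if U.2.2 = 0 then OnePoint.infty else ((U.2.1 / U.2.2 : ℝ) : OnePoint ℝ)

lemma Rep.p_pos {γ : ℝ → ℍ} {U V : ℝ × ℝ × ℝ} (h : Rep γ U V) (h0 : U.2.2 = 0) :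
    0 < U.1 ∧ U.2.1 = 0 := by
  have h1 := h.uu
  have h2 := h.uv
  simp only [B, h0] at h1 h2
  have hq : U.2.1 = 0 := by nlinarith
  refine ⟨lt_of_le_of_ne h.up fun hh => ?_, hq⟩
  rw [← hh, hq] at h2
  norm_num at h2

lemma Rep.tendsto {γ : ℝ → ℍ} {U V : ℝ × ℝ × ℝ} (h : Rep γ U V) :
    Tendsto (fun t => embH (γ t)) atTop (𝓝 (toC (pt U))) := by
  have e1 : ∀ t, ((γ t).re ^ 2 + (γ t).im ^ 2) / (γ t).im
      = Real.exp t * U.1 + Real.exp (-t) * V.1 := fun t => by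
    simpa [X] using congrArg (fun v : ℝ × ℝ × ℝ => v.1) (h.eq t)
  have e2 : ∀ t, (γ t).re / (γ t).im
      = Real.exp t * U.2.1 + Real.exp (-t) * V.2.1 := fun t => by
    simpa [X] using congrArg (fun v : ℝ × ℝ × ℝ => v.2.1) (h.eq t)
  have e3 : ∀ t, 1 / (γ t).im
      = Real.exp t * U.2.2 + Real.exp (-t) * V.2.2 := fun t => by
    simpa [X] using congrArg (fun v : ℝ × ℝ × ℝ => v.2.2) (h.eq t)
  have l1 := lim_exp U.1 V.1
  have l2 := lim_exp U.2.1 V.2.1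
  have l3 := lim_exp U.2.2 V.2.2
  simp only [← e1] at l1
  simp only [← e2] at l2
  simp only [← e3] at l3
  by_cases h0 : U.2.2 = 0
  · obtain ⟨hp, hq⟩ := h.p_pos h0
    have hpt : toC (pt U) = OnePoint.infty := by simp [pt, h0, toC]
    rw [hpt]
    have hc : Tendsto (fun t => ((γ t : ℍ) : ℂ)) atTop (coclosedCompact ℂ) := by
      rw [coclosedCompact_eq_cocompact, ← Metric.cobounded_eq_cocompact, ← comap_norm_atTop, tendsto_comap_iff]
      have hsq : Tendsto (fun t => ‖((γ t : ℍ) : ℂ)‖ ^ 2) atTop atTop := by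
        rw [h0] at l3
        have l3' : Tendsto (fun t => Real.exp (-t) * (1 / (γ t).im)) atTop (𝓝[>] 0) :=
          tendsto_nhdsWithin_iff.2 ⟨l3, Eventually.of_forall fun t => by
            have := (γ t).im_pos
            simp only [Set.mem_Ioi]; positivity⟩
        have := Filter.Tendsto.pos_mul_atTop hp l1 l3'.inv_tendsto_nhdsGT_zero
        refine this.congr fun t => ?_
        have := (γ t).im_pos.ne'
        have := (Real.exp_pos (-t)).ne'
        rw [Complex.sq_norm, Complex.normSq_apply]
        simp only [Pi.inv_apply, UpperHalfPlane.coe_re, UpperHalfPlane.coe_im]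
        field_simp
      have := (Real.tendsto_sqrt_atTop).comp hsq
      refine this.congr fun t => ?_
      simp [Real.sqrt_sq]
    exact OnePoint.tendsto_coe_infty.comp hc
  · have hpt : toC (pt U) = (((U.2.1 / U.2.2 : ℝ) : ℂ) : OnePoint ℂ) := by
      simp only [pt, h0, toC, if_false]; rfl
    rw [hpt]
    have hre : Tendsto (fun t => (γ t).re) atTop (𝓝 (U.2.1 / U.2.2)) := by
      refine (l2.div l3 h0).congr fun t => ?_
      have := (γ t).im_pos.ne'
      have := (Real.exp_pos (-t)).ne'
      simp only [Pi.div_apply]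
      field_simp
    have him : Tendsto (fun t => (γ t).im) atTop (𝓝 0) := by
      have := (Real.tendsto_exp_neg_atTop_nhds_zero).div l3 h0
      rw [zero_div] at this
      refine this.congr fun t => ?_
      have := (γ t).im_pos.ne'
      have := (Real.exp_pos (-t)).ne'
      simp only [Pi.div_apply]
      field_simp
    have hc : Tendsto (fun t => ((γ t : ℍ) : ℂ)) atTop (𝓝 ((U.2.1 / U.2.2 : ℝ) : ℂ)) := by
      have h1 : Tendsto (fun t => (((γ t).re : ℝ) : ℂ) + (((γ t).im : ℝ) : ℂ) * Complex.I) atTop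
          (𝓝 (((U.2.1 / U.2.2 : ℝ) : ℂ) + ((0 : ℝ) : ℂ) * Complex.I)) :=
        ((Complex.continuous_ofReal.tendsto _).comp hre).add
          (((Complex.continuous_ofReal.tendsto _).comp him).mul_const _)
      simp only [Complex.ofReal_zero, zero_mul, add_zero] at h1
      refine h1.congr fun t => ?_
      apply Complex.ext <;> simp
    exact (OnePoint.continuous_coe.tendsto _).comp hc

lemma toC_injective : Function.Injective toC := by
  intro a b h
  induction a using OnePoint.rec <;> induction b using OnePoint.rec
  · rfl
  · exact absurd h.symm (OnePoint.coe_ne_infty _)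
  · exact absurd h (OnePoint.coe_ne_infty _)
  · exact congrArg _ (Complex.ofReal_injective (OnePoint.coe_injective h))

lemma Rep.pt_eq {γ : ℝ → ℍ} {U V : ℝ × ℝ × ℝ} (h : Rep γ U V) {ξ : OnePoint ℝ}
    (hξ : Tendsto (fun t => embH (γ t)) atTop (𝓝 (toC ξ))) : ξ = pt U :=
  toC_injective (tendsto_nhds_unique hξ h.tendsto)

lemma prop_of_pt_eq {γ γ' : ℝ → ℍ} {U V U' V' : ℝ × ℝ × ℝ} (h : Rep γ U V) (h' : Rep γ' U' V')
    (he : pt U = pt U') : ∃ c : ℝ, c > 0 ∧ U' = c • U := by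
  by_cases h0 : U.2.2 = 0
  · by_cases h0' : U'.2.2 = 0
    · obtain ⟨hp, hq⟩ := h.p_pos h0
      obtain ⟨hp', hq'⟩ := h'.p_pos h0'
      refine ⟨U'.1 / U.1, by positivity, ?_⟩
      ext
      · simp [hp.ne']
      · simp [hq, hq']
      · simp [h0, h0']
    · simp [pt, h0, h0'] at he
  · by_cases h0' : U'.2.2 = 0
    · simp [pt, h0, h0'] at he
    · have he' : U.2.1 / U.2.2 = U'.2.1 / U'.2.2 := by
        simp only [pt, h0, h0', if_false] at he
        exact OnePoint.coe_injective he
      have hr : 0 < U.2.2 := lt_of_le_of_ne h.ur (Ne.symm h0)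
      have hr' : 0 < U'.2.2 := lt_of_le_of_ne h'.ur (Ne.symm h0')
      have hu := h.uu
      have hu' := h'.uu
      simp only [B] at hu hu'
      have hq : U'.2.1 = U'.2.2 / U.2.2 * U.2.1 := by
        field_simp at he' ⊢
        linarith
      refine ⟨U'.2.2 / U.2.2, by positivity, ?_⟩
      ext
      · have h1 : U.1 = U.2.1 ^ 2 / U.2.2 := by field_simp; linarith
        have h2 : U'.1 = U'.2.1 ^ 2 / U'.2.2 := by field_simp; linarith
        simp only [Prod.smul_fst, smul_eq_mul]
        rw [h2, h1, hq]
        field_simp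
      · simpa using hq
      · simp [h0]

lemma B_pos_of_pt_ne {γ γ' : ℝ → ℍ} {U V U' V' : ℝ × ℝ × ℝ} (h : Rep γ U V) (h' : Rep γ' U' V')
    (he : pt U ≠ pt U') : 0 < B U U' := by
  by_cases h0 : U.2.2 = 0
  · by_cases h0' : U'.2.2 = 0
    · simp [pt, h0, h0'] at he
    · obtain ⟨hp, hq⟩ := h.p_pos h0
      have hr' : 0 < U'.2.2 := lt_of_le_of_ne h'.ur (Ne.symm h0')
      simp only [B, h0, hq]
      have := mul_pos hp hr'
      linarith
  · have hr : 0 < U.2.2 := lt_of_le_of_ne h.ur (Ne.symm h0)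
    by_cases h0' : U'.2.2 = 0
    · obtain ⟨hp, hq⟩ := h'.p_pos h0'
      simp only [B, h0', hq]
      have := mul_pos hr hp
      linarith
    · have hr' : 0 < U'.2.2 := lt_of_le_of_ne h'.ur (Ne.symm h0')
      have hu := h.uu
      have hu' := h'.uu
      simp only [B] at hu hu'
      have h1 : U.1 = U.2.1 ^ 2 / U.2.2 := by field_simp; linarith
      have h2 : U'.1 = U'.2.1 ^ 2 / U'.2.2 := by field_simp; linarith
      have h3 : B U U' = (U.2.1 / U.2.2 - U'.2.1 / U'.2.2) ^ 2 * (U.2.2 * U'.2.2) / 2 := by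
        simp only [B]
        rw [h1, h2]
        field_simp
        ring
      rw [h3]
      have : U.2.1 / U.2.2 - U'.2.1 / U'.2.2 ≠ 0 := by
        intro hh
        apply he
        simp only [pt, h0, h0', if_false]
        rw [sub_eq_zero.1 hh]
      positivity

lemma Rep.cosh {γ γ' : ℝ → ℍ} {U V U' V' : ℝ × ℝ × ℝ} (h : Rep γ U V) (h' : Rep γ' U' V')
    (s t : ℝ) : Real.cosh (dist (γ s) (γ' t)) =
      Real.exp s * Real.exp t * B U U' + Real.exp s * Real.exp (-t) * B U V' +
      Real.exp (-s) * Real.exp t * B V U' + Real.exp (-s) * Real.exp (-t) * B V V' := by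
  rw [cosh_dist_eq, h.eq, h'.eq]
  simp only [B, Prod.fst_add, Prod.snd_add, Prod.smul_fst, Prod.smul_snd, smul_eq_mul]
  ring

lemma not_sep {γ γ' : ℝ → ℍ} {U V U' V' : ℝ × ℝ × ℝ} (h : Rep γ U V) (h' : Rep γ' U' V')
    {K : ℝ} (hK : 0 < K) (hd : ∀ s t, K ≤ dist (γ s) (γ' t)) : pt U ≠ pt U' := by
  intro he
  obtain ⟨c, hc, hU'⟩ := prop_of_pt_eq h h' he
  have b1 : B U U' = 0 := by
    have := h.uu
    rw [hU']
    simp only [B, Prod.smul_fst, Prod.smul_snd, smul_eq_mul] at this ⊢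
    linear_combination c * this
  have b2 : B U V' = 1 / (2 * c) := by
    have := h'.uv
    rw [hU'] at this
    simp only [B, Prod.smul_fst, Prod.smul_snd, smul_eq_mul] at this ⊢
    field_simp
    linear_combination 2 * this
  have b3 : B V U' = c / 2 := by
    have := h.uv
    rw [hU']
    simp only [B, Prod.smul_fst, Prod.smul_snd, smul_eq_mul] at this ⊢
    linear_combination c * this
  have hlim : Tendsto (fun s : ℝ => 1 + Real.exp (-s) * Real.exp (-s) * (c * B V V')) atTop
      (𝓝 (1 + 0 * 0 * (c * B V V'))) :=
    ((Real.tendsto_exp_neg_atTop_nhds_zero.mul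
      Real.tendsto_exp_neg_atTop_nhds_zero).mul_const _).const_add 1
  have hge : ∀ s : ℝ, Real.cosh K ≤ 1 + Real.exp (-s) * Real.exp (-s) * (c * B V V') := by
    intro s
    have h1 : Real.cosh K ≤ Real.cosh (dist (γ s) (γ' (s - Real.log c))) := by
      rw [Real.cosh_le_cosh, abs_of_pos hK, abs_of_nonneg dist_nonneg]
      exact hd _ _
    rw [h.cosh h', b1, b2, b3] at h1
    refine h1.trans_eq ?_
    have e1 : Real.exp (s - Real.log c) = Real.exp s / c := by
      rw [Real.exp_sub, Real.exp_log hc]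
    rw [Real.exp_neg (s - Real.log c), e1, Real.exp_neg]
    have := Real.exp_pos s
    field_simp
    ring
  have := ge_of_tendsto' hlim hge
  have h2 : 1 < Real.cosh K := Real.one_lt_cosh.2 hK.ne'
  linarith

lemma corner_lim {γ γ' : ℝ → ℍ} {U V U' V' : ℝ × ℝ × ℝ} (h : Rep γ U V) (h' : Rep γ' U' V') :
    Tendsto (fun s : ℝ => Real.exp (-s) * Real.exp (-s) * Real.cosh (dist (γ s) (γ' s))) atTop
      (𝓝 (B U U')) := by
  have l := Real.tendsto_exp_neg_atTop_nhds_zero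
  have l2 := l.mul l
  have := ((l2.mul_const (B U V' + B V U')).add ((l2.mul l2).mul_const (B V V'))).const_add (B U U')
  simp only [mul_zero, zero_mul, add_zero] at this
  refine this.congr fun s => ?_
  rw [h.cosh h', Real.exp_neg]
  have := Real.exp_pos s
  field_simp
  ring

lemma corner {γ γ' δ δ' : ℝ → ℍ} {U V U' V' S T S' T' : ℝ × ℝ × ℝ} (h : Rep γ U V)
    (h' : Rep γ' U' V') (k : Rep δ S T) (k' : Rep δ' S' T') {c : ℝ}
    (hd : ∀ᶠ s in atTop, dist (δ s) (δ' s) ≤ dist (γ s) (γ' s) - c) :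
    B S S' ≤ Real.exp (-c) * B U U' := by
  have l := Real.tendsto_exp_neg_atTop_nhds_zero
  have l1 := ((corner_lim h h').const_mul (Real.exp (-c))).add ((l.mul l).mul_const (1 / 2))
  simp only [zero_mul, add_zero] at l1
  refine le_of_tendsto_of_tendsto (corner_lim k k') l1 ?_
  filter_upwards [hd] with s hs
  have h1 : Real.cosh (dist (δ s) (δ' s))
      ≤ Real.exp (-c) * Real.cosh (dist (γ s) (γ' s)) + 1 / 2 := by
    have e1 : Real.exp (dist (δ s) (δ' s)) ≤ Real.exp (-c) * Real.exp (dist (γ s) (γ' s)) := by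
      rw [← Real.exp_add]; exact Real.exp_le_exp.2 (by linarith)
    have e2 : Real.exp (-dist (δ s) (δ' s)) ≤ 1 :=
      Real.exp_le_one_iff.2 (neg_nonpos.2 dist_nonneg)
    have e3 : 0 < Real.exp (-c) * Real.exp (-dist (γ s) (γ' s)) := by positivity
    rw [Real.cosh_eq, Real.cosh_eq]
    linarith
  have h2 : 0 < Real.exp (-s) * Real.exp (-s) := by positivity
  nlinarith [mul_le_mul_of_nonneg_left h1 h2.le]

/-- Sign of a boolean. -/
def sg (ε : Bool) : ℝ := cond ε 1 (-1)

lemma tendsto_sg (ε : Bool) :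
    Tendsto (fun t : ℝ => sg ε * t) atTop (cond ε atTop atBot) := by
  cases ε
  · simpa [sg] using tendsto_neg_atTop_atBot
  · simp only [sg, cond_true, one_mul]; exact tendsto_id

lemma Rep.sgn {γ : ℝ → ℍ} {U V : ℝ × ℝ × ℝ} (h : Rep γ U V) (ε : Bool) :
    Rep (fun t => γ (sg ε * t)) (cond ε U V) (cond ε V U) := by
  cases ε
  · simpa [sg] using h.symm
  · simpa [sg] using h

lemma psl_isometry (g : PSL2) : Isometry (pslSMul g) := isometry_smul ℍ (Quotient.out g : SL2)

lemma dist_le_of {d d' K : ℝ} (hd : 0 ≤ d) (hd' : 0 ≤ d') (hK : 0 < K)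
    (h : Real.cosh d' ≤ Real.exp (-K) * Real.cosh d) : d' ≤ d - K := by
  have hKe : Real.exp (-K) * Real.exp K = 1 := by rw [← Real.exp_add]; simp
  have hpos := Real.exp_pos (-K)
  have hpos' := Real.exp_pos K
  have h1 : Real.exp K ≤ Real.cosh d := by
    have := Real.one_le_cosh d'
    have h3 : 1 ≤ Real.exp (-K) * Real.cosh d := this.trans h
    nlinarith [mul_le_mul_of_nonneg_left h3 hpos'.le]
  have hle : Real.exp (-K) ≤ Real.exp K := Real.exp_le_exp.2 (by linarith)
  have h2 : K ≤ d := by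
    have : Real.cosh K ≤ Real.cosh d := by
      rw [Real.cosh_eq]; linarith
    rwa [Real.cosh_le_cosh, abs_of_pos hK, abs_of_nonneg hd] at this
  have h3 : Real.cosh d' ≤ Real.cosh (d - K) := by
    refine h.trans ?_
    rw [Real.cosh_eq, Real.cosh_eq]
    have e1 : Real.exp (d - K) = Real.exp (-K) * Real.exp d := by
      rw [← Real.exp_add]; congr 1; ring
    have e2 : Real.exp (-(d - K)) = Real.exp K * Real.exp (-d) := by
      rw [← Real.exp_add]; congr 1; ring
    rw [e1, e2]
    have := mul_le_mul_of_nonneg_right hle (Real.exp_pos (-d)).le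
    linarith
  rwa [Real.cosh_le_cosh, abs_of_nonneg hd', abs_of_nonneg (by linarith)] at h3

end Stmt4Aux

theorem stmt4 (γ γ' : ℝ → ℍ) (hγ : Isometry γ) (hγ' : Isometry γ')
    (ξ ξ' : Bool → OnePoint ℝ)
    (hξ : ∀ ε : Bool, Tendsto (fun t => embH (γ t)) (cond ε atTop atBot) (𝓝 (toC (ξ ε))))
    (hξ' : ∀ ε : Bool, Tendsto (fun t => embH (γ' t)) (cond ε atTop atBot) (𝓝 (toC (ξ' ε))))
    (g g' : PSL2) :
    (∃ K > 0, ∀ s t : ℝ,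
        dist (pslSMul g (γ s)) (pslSMul g' (γ' t)) ≤ dist (γ s) (γ' t) - K) ↔
      ∀ ε ε' : Bool, ξ ε ≠ ξ' ε' ∧
        Filter.limsup
          (fun p : ℝ × ℝ =>
            ((dist (pslSMul g (γ p.1)) (pslSMul g' (γ' p.2)) - dist (γ p.1) (γ' p.2) : ℝ) :
              EReal))
          ((cond ε atTop atBot) ×ˢ (cond ε' atTop atBot)) < 0 := by
  obtain ⟨U, V, h⟩ := Stmt4Aux.exists_rep hγ
  obtain ⟨U', V', h'⟩ := Stmt4Aux.exists_rep hγ'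
  obtain ⟨S, T, k⟩ := Stmt4Aux.exists_rep ((Stmt4Aux.psl_isometry g).comp hγ)
  obtain ⟨S', T', k'⟩ := Stmt4Aux.exists_rep ((Stmt4Aux.psl_isometry g').comp hγ')
  have hx : ∀ ε, ξ ε = Stmt4Aux.pt (cond ε U V) := fun ε =>
    (h.sgn ε).pt_eq ((hξ ε).comp (Stmt4Aux.tendsto_sg ε))
  have hx' : ∀ ε, ξ' ε = Stmt4Aux.pt (cond ε U' V') := fun ε =>
    (h'.sgn ε).pt_eq ((hξ' ε).comp (Stmt4Aux.tendsto_sg ε))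
  constructor
  · rintro ⟨K, hK, hd⟩ ε ε'
    constructor
    · rw [hx, hx']
      refine Stmt4Aux.not_sep (h.sgn ε) (h'.sgn ε') hK fun s t => ?_
      have h1 := hd (Stmt4Aux.sg ε * s) (Stmt4Aux.sg ε' * t)
      have h2 : 0 ≤ dist (pslSMul g (γ (Stmt4Aux.sg ε * s)))
        (pslSMul g' (γ' (Stmt4Aux.sg ε' * t))) := dist_nonneg
      linarith
    · refine lt_of_le_of_lt (b := ((-K : ℝ) : EReal)) ?_ ?_
      · refine Filter.limsup_le_of_le (h := Eventually.of_forall fun p => ?_)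
        have := hd p.1 p.2
        exact EReal.coe_le_coe_iff.2 (by linarith)
      · exact_mod_cast (neg_neg_of_pos hK)
  · intro H
    have key : ∀ ε ε', ∃ c > 0, Stmt4Aux.B (cond ε S T) (cond ε' S' T') ≤
        Real.exp (-c) * Stmt4Aux.B (cond ε U V) (cond ε' U' V') := by
      intro ε ε'
      obtain ⟨r, hr1, hr2⟩ := EReal.lt_iff_exists_real_btwn.1 (H ε ε').2
      have hr0 : r < 0 := by exact_mod_cast hr2
      have hev := Filter.eventually_lt_of_limsup_lt hr1
      have ht : Tendsto (fun s : ℝ => (Stmt4Aux.sg ε * s, Stmt4Aux.sg ε' * s)) atTop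
          ((cond ε atTop atBot) ×ˢ (cond ε' atTop atBot)) :=
        (Stmt4Aux.tendsto_sg ε).prodMk (Stmt4Aux.tendsto_sg ε')
      refine ⟨-r, by linarith, Stmt4Aux.corner (h.sgn ε) (h'.sgn ε') (k.sgn ε) (k'.sgn ε') ?_⟩
      filter_upwards [ht.eventually hev] with s hs
      have hs' := EReal.coe_lt_coe_iff.1 hs
      simp only [Function.comp_apply] at hs' ⊢
      linarith
    have apos : ∀ ε ε', 0 < Stmt4Aux.B (cond ε U V) (cond ε' U' V') := by
      intro ε ε'
      refine Stmt4Aux.B_pos_of_pt_ne (h.sgn ε) (h'.sgn ε') ?_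
      rw [← hx, ← hx']
      exact (H ε ε').1
    choose c hc hcb using key
    obtain ⟨K, hK, hKc⟩ : ∃ K > 0, ∀ ε ε', K ≤ c ε ε' := by
      refine ⟨min (min (c true true) (c true false)) (min (c false true) (c false false)), ?_, ?_⟩
      · simp [hc]
      · intro ε ε'
        cases ε <;> cases ε' <;> simp
    have hb : ∀ ε ε', Stmt4Aux.B (cond ε S T) (cond ε' S' T') ≤
        Real.exp (-K) * Stmt4Aux.B (cond ε U V) (cond ε' U' V') := fun ε ε' =>
      (hcb ε ε').trans (mul_le_mul_of_nonneg_right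
        (Real.exp_le_exp.2 (neg_le_neg (hKc ε ε'))) (apos ε ε').le)
    refine ⟨K, hK, fun s t => Stmt4Aux.dist_le_of dist_nonneg dist_nonneg hK ?_⟩
    have e := k.cosh k' s t
    simp only [Function.comp_apply] at e
    rw [e, h.cosh h']
    have h1 := mul_le_mul_of_nonneg_left (hb true true)
      (mul_pos (Real.exp_pos s) (Real.exp_pos t)).le
    have h2 := mul_le_mul_of_nonneg_left (hb true false)
      (mul_pos (Real.exp_pos s) (Real.exp_pos (-t))).le
    have h3 := mul_le_mul_of_nonneg_left (hb false true)
      (mul_pos (Real.exp_pos (-s)) (Real.exp_pos t)).le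
    have h4 := mul_le_mul_of_nonneg_left (hb false false)
      (mul_pos (Real.exp_pos (-s)) (Real.exp_pos (-t))).le
    simp only [cond_true, cond_false] at h1 h2 h3 h4
    linarith

end
end
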